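/- arXiv:2605.25088 — 2 statements merged into one kernel-verified Lean document; each statement's English description precedes it below -/
import Mathlib

section
/- For every fixed real number c with 0 < c < 1/4, there exists n₀ such that for all n ≥ n₀, the number of distinct values of τ(G), as G ranges over all simple graphs on n labelled vertices, is at least exp(c · n · log n). That is, |𝒯_n| ≥ exp(c n log n) for all sufficiently large n. -/
/-- The number of spanning trees of a simple graph `G`: the number of
spanning subgraphs of `G` that are trees. -/
noncomputable def tau {V : Type} (G : SimpleGraph V) : ℕ :=
  Nat.card {H : SimpleGraph V // H ≤ G ∧ H.IsTree}

/-- The spanning-tree spectrum of simple graphs on `n` labelled vertices. -/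
noncomputable def treeSpectrum (n : ℕ) : Set ℕ :=
  Set.range (fun G : SimpleGraph (Fin n) => tau G)

/-- `f` is a parent function for the root `r`: iterating it leads every vertex to the fixed
point `r`. -/
def IsParentFun {V : Type*} (r : V) (f : V → V) : Prop :=
  f r = r ∧ ∀ v, ∃ k, f^[k] v = r

/-- The matrix of the functional graph of `f`, rooted at `r`: the identity minus the transition
matrix of `f` away from `r`. -/
def parentMatrix {V : Type*} [DecidableEq V] (r : V) (f : V → V) : Matrix V V ℤ :=
  Matrix.of fun v => Pi.single v 1 - if v = r then 0 else Pi.single (f v) 1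

theorem det_parentMatrix_of_isParentFun {V : Type*} [Fintype V] [DecidableEq V] {r : V}
    {f : V → V} (hf : IsParentFun r f) : (parentMatrix r f).det = 1 := by
  classical
  set d : V → ℕ := fun v => Nat.find (hf.2 v) with hd
  have hlt : ∀ v, v ≠ r → d (f v) < d v := by
    intro v hv
    have h := Nat.find_spec (hf.2 v)
    obtain ⟨k, hk⟩ : ∃ k, Nat.find (hf.2 v) = k + 1 := by
      refine Nat.exists_eq_succ_of_ne_zero fun h0 => hv ?_
      rw [h0] at h
      exact h
    rw [hk, Function.iterate_succ_apply] at h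
    have := Nat.find_min' (hf.2 (f v)) h
    simp only [hd]
    omega
  have hentry : ∀ i j, i ≠ j → d i ≤ d j → parentMatrix r f i j = 0 := by
    intro i j hij hle
    by_cases hi : i = r
    · have hj : j ≠ r := fun h => hij (hi.trans h.symm)
      simp [parentMatrix, hi, hj]
    · have : j ≠ f i := fun h => by have := hlt i hi; rw [← h] at this; omega
      simp [parentMatrix, hi, hij.symm, this]
  have hdiag : ∀ i, parentMatrix r f i i = 1 := by
    intro i
    by_cases hi : i = r
    · simp [parentMatrix, hi]
    · have : i ≠ f i := fun h => by have := hlt i hi; rw [← h] at this; omega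
      simp [parentMatrix, hi, this]
  have hT : (parentMatrix r f).BlockTriangular (OrderDual.toDual ∘ d) := by
    intro i j hij
    have hij' : d i < d j := hij
    exact hentry i j (fun h => by simp [h] at hij') hij'.le
  rw [hT.det]
  refine Finset.prod_eq_one fun a _ => ?_
  suffices h : (parentMatrix r f).toSquareBlock (OrderDual.toDual ∘ d) a = 1 by
    rw [h, Matrix.det_one]
  ext ⟨i, hi⟩ ⟨j, hj⟩
  by_cases hij : i = j
  · subst hij
    simp [Matrix.toSquareBlock, Matrix.toSquareBlockProp, hdiag]
  · have : d i ≤ d j := by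
      have : OrderDual.toDual (d i) = OrderDual.toDual (d j) := hi.trans hj.symm
      exact (OrderDual.toDual.injective this).le
    simp [Matrix.toSquareBlock, Matrix.toSquareBlockProp, hij, hentry i j hij this]

theorem det_parentMatrix_of_not_isParentFun {V : Type*} [Fintype V] [DecidableEq V] {r : V}
    {f : V → V} (hr : f r = r) (hf : ¬ IsParentFun r f) : (parentMatrix r f).det = 0 := by
  classical
  obtain ⟨w, hw⟩ : ∃ v, ∀ k, f^[k] v ≠ r := by
    by_contra! h
    exact hf ⟨hr, h⟩
  refine Matrix.exists_mulVec_eq_zero_iff.1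
    ⟨fun v => if ∀ k, f^[k] v ≠ r then 1 else 0, fun h => ?_, ?_⟩
  · have := congrFun h w
    simp [hw] at this
  · ext v
    have hrr : ¬ ∀ k, f^[k] r ≠ r := fun h => h 0 rfl
    have hstep : (∀ k, f^[k] (f v) ≠ r) ↔ ∀ k, f^[k] v ≠ r := by
      simp only [← Function.iterate_succ_apply]
      refine ⟨fun h k => ?_, fun h k => h _⟩
      cases k with
      | zero =>
        intro h0
        apply h 0
        have : v = r := h0
        simp [this, hr]
      | succ k => exact h k
    have hval : (parentMatrix r f).mulVec (fun v => if ∀ k, f^[k] v ≠ r then (1 : ℤ) else 0) v =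
        (if ∀ k, f^[k] v ≠ r then (1 : ℤ) else 0) -
          if v = r then 0 else if ∀ k, f^[k] (f v) ≠ r then (1 : ℤ) else 0 := by
      have : parentMatrix r f v = Pi.single v 1 - if v = r then 0 else Pi.single (f v) 1 := rfl
      rw [Matrix.mulVec, this, sub_dotProduct, single_one_dotProduct]
      by_cases hv : v = r
      · simp [hv]
      · simp only [hv, if_false, single_one_dotProduct]
    rw [hval, if_congr hstep rfl rfl]
    by_cases hv : v = r
    · subst hv
      rw [if_neg hrr]
      simp
    · simp [hv]

/-- The Laplacian of `G` with the row of the root `r` replaced by a unit vector. -/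
noncomputable def rootedLaplacian {V : Type*} [Fintype V] [DecidableEq V] (G : SimpleGraph V)
    [DecidableRel G.Adj] (r : V) : Matrix V V ℤ :=
  (G.lapMatrix ℤ).updateRow r (Pi.single r 1)

theorem det_rootedLaplacian {V : Type*} [Fintype V] [DecidableEq V] (G : SimpleGraph V)
    [DecidableRel G.Adj] (r : V) : (rootedLaplacian G r).det =
      Nat.card {f : V → V // IsParentFun r f ∧ ∀ v, v ≠ r → G.Adj v (f v)} := by
  classical
  have hrow : rootedLaplacian G r = fun v => ∑ u ∈ (if v = r then {r} else G.neighborFinset v),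
      (Pi.single v 1 - if v = r then 0 else Pi.single u 1 : V → ℤ) := by
    ext v u
    by_cases hv : v = r
    · simp [rootedLaplacian, hv]
    · simp [rootedLaplacian, hv, Matrix.updateRow_ne, SimpleGraph.lapMatrix,
        SimpleGraph.degMatrix, Matrix.diagonal_apply, Pi.single_apply,
        SimpleGraph.adjMatrix_apply, eq_comm]
  have hdet : (rootedLaplacian G r).det = ∑ f ∈ Fintype.piFinset
      (fun v => if v = r then {r} else G.neighborFinset v), (parentMatrix r f).det := by
    rw [hrow]
    exact (Matrix.detRowAlternating (R := ℤ)).toMultilinearMap.map_sum_finset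
      (fun v u => (Pi.single v 1 - if v = r then 0 else Pi.single u 1 : V → ℤ)) _
  have hmem : ∀ f : V → V, f ∈ Fintype.piFinset
      (fun v => if v = r then {r} else G.neighborFinset v) ↔
        f r = r ∧ ∀ v, v ≠ r → G.Adj v (f v) := by
    intro f
    rw [Fintype.mem_piFinset]
    constructor
    · intro h
      refine ⟨by simpa using h r, fun v hv => by simpa [hv] using h v⟩
    · rintro ⟨h1, h2⟩ v
      by_cases hv : v = r
      · simp [hv, h1]
      · simpa [hv] using h2 v hv
  have hterm : ∀ f ∈ Fintype.piFinset (fun v => if v = r then {r} else G.neighborFinset v),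
      (parentMatrix r f).det = if IsParentFun r f then 1 else 0 := by
    intro f hf
    split_ifs with h
    · exact det_parentMatrix_of_isParentFun h
    · exact det_parentMatrix_of_not_isParentFun ((hmem f).1 hf).1 h
  rw [hdet, Finset.sum_congr rfl hterm, Finset.sum_boole, Nat.card_eq_fintype_card,
    Fintype.card_subtype]
  congr 2
  ext f
  simp only [Finset.mem_filter, hmem, Finset.mem_univ, true_and]
  exact ⟨fun h => ⟨h.2, h.1.2⟩, fun h => ⟨⟨h.1.1, h.2⟩, h.1⟩⟩

/-- The graph joining every vertex to its image under `f`. -/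
def functionalGraph {V : Type*} (f : V → V) : SimpleGraph V :=
  SimpleGraph.fromRel fun u v => f u = v

theorem functionalGraph_le {V : Type*} {G : SimpleGraph V} {r : V} {f : V → V} (hr : f r = r)
    (h : ∀ v, v ≠ r → G.Adj v (f v)) : functionalGraph f ≤ G := by
  have key : ∀ u v, u ≠ v → f u = v → G.Adj u v := by
    rintro u _ huv rfl
    exact h u fun hu => huv (by rw [hu, hr])
  intro u v huv
  obtain ⟨hne, h1 | h1⟩ := (SimpleGraph.fromRel_adj _ _ _).1 huv
  · exact key u v hne h1
  · exact (key v u hne.symm h1).symm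

theorem IsParentFun.connected_functionalGraph {V : Type*} {r : V} {f : V → V}
    (hf : IsParentFun r f) : (functionalGraph f).Connected := by
  have hreach : ∀ k v, f^[k] v = r → (functionalGraph f).Reachable v r := by
    intro k
    induction k with
    | zero => rintro v rfl; exact SimpleGraph.Reachable.refl _
    | succ k ih =>
      intro v hv
      rw [Function.iterate_succ_apply] at hv
      refine SimpleGraph.Reachable.trans ?_ (ih _ hv)
      by_cases h : v = f v
      · rw [← h]
      · exact SimpleGraph.Adj.reachable ((SimpleGraph.fromRel_adj _ _ _).2 ⟨h, Or.inl rfl⟩)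
  have hall : ∀ v, (functionalGraph f).Reachable v r := fun v =>
    (hf.2 v).elim fun k hk => hreach k v hk
  have : Nonempty V := ⟨r⟩
  exact SimpleGraph.Connected.mk fun u v => (hall u).trans (hall v).symm

theorem IsParentFun.isTree_functionalGraph {V : Type*} [Finite V] {r : V} {f : V → V}
    (hf : IsParentFun r f) : (functionalGraph f).IsTree := by
  classical
  have hc := hf.connected_functionalGraph
  have := Fintype.ofFinite V
  refine SimpleGraph.isTree_iff_connected_and_card.2 ⟨hc, le_antisymm ?_
    hc.card_vert_le_card_edgeSet_add_one⟩
  have hsub : (functionalGraph f).edgeSet ⊆ (fun v => s(v, f v)) '' {v | v ≠ r} := by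
    intro e
    induction e with | _ u v =>
    intro he
    obtain ⟨hne, h1 | h1⟩ := (SimpleGraph.fromRel_adj _ _ _).1 ((functionalGraph f).mem_edgeSet.1 he)
    · exact ⟨u, fun hu => hne (by rw [← h1, hu, hf.1]), by simp [h1]⟩
    · exact ⟨v, fun hu => hne (by rw [← h1, hu, hf.1]), by simp [h1, Sym2.eq_swap]⟩
  have h1 : Nat.card (functionalGraph f).edgeSet ≤ ({v | v ≠ r} : Set V).ncard :=
    (Set.ncard_le_ncard hsub (Set.toFinite _)).trans (Set.ncard_image_le (Set.toFinite _))
  have h2 : ({v | v ≠ r} : Set V).ncard + 1 = Nat.card V := by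
    have : ({v | v ≠ r} : Set V) = {r}ᶜ := rfl
    rw [this, ← Set.ncard_singleton r, add_comm, Set.ncard_add_ncard_compl]
  omega

theorem IsParentFun.ext_of_functionalGraph_eq {V : Type*} {r : V} {f g : V → V}
    (hf : IsParentFun r f) (hg : IsParentFun r g) (h : functionalGraph f = functionalGraph g) :
    f = g := by
  have hne : ∀ v, v ≠ r → f v ≠ v := by
    intro v hv hfix
    obtain ⟨k, hk⟩ := hf.2 v
    rw [Function.iterate_fixed hfix] at hk
    exact hv hk
  have key : ∀ k v, f^[k] v = r → f v = g v := by
    intro k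
    induction k with
    | zero =>
      intro v hv
      have : v = r := hv
      rw [this, hf.1, hg.1]
    | succ k ih =>
      intro v hv
      by_cases hvr : v = r
      · rw [hvr, hf.1, hg.1]
      rw [Function.iterate_succ_apply] at hv
      have h1 := ih _ hv
      have hadj : (functionalGraph g).Adj v (f v) :=
        h ▸ (SimpleGraph.fromRel_adj _ _ _).2 ⟨(hne v hvr).symm, Or.inl rfl⟩
      obtain ⟨-, h2 | h2⟩ := (SimpleGraph.fromRel_adj _ _ _).1 hadj
      · exact h2.symm
      · exfalso
        have hcyc : f (f v) = v := h1.trans h2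
        have hfv : f v ≠ r := fun h3 => hvr (by rw [← hcyc, h3, hf.1])
        have : ∀ j, f^[j] v = v ∨ f^[j] v = f v := by
          intro j
          induction j with
          | zero => exact Or.inl rfl
          | succ j ihj =>
            rw [Function.iterate_succ_apply']
            rcases ihj with h | h <;> rw [h]
            · exact Or.inr rfl
            · exact Or.inl hcyc
        obtain ⟨j, hj⟩ := hf.2 v
        rcases this j with h | h
        · exact hvr (h.symm.trans hj)
        · exact hfv (h.symm.trans hj)
  funext v
  obtain ⟨k, hk⟩ := hf.2 v
  exact key k v hk

theorem SimpleGraph.IsTree.exists_isParentFun {V : Type*} {H : SimpleGraph V} (hH : H.IsTree)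
    (r : V) : ∃ f, IsParentFun r f ∧ (∀ v, v ≠ r → H.Adj v (f v)) ∧ functionalGraph f = H := by
  classical
  have hstep : ∀ v, ∃ w, (v = r → w = r) ∧ (v ≠ r → H.Adj v w ∧ H.dist w r + 1 = H.dist v r) := by
    intro v
    by_cases hv : v = r
    · exact ⟨r, fun _ => rfl, fun h => absurd hv h⟩
    · obtain ⟨p, hp⟩ := hH.connected.exists_walk_length_eq_dist v r
      cases p with
      | nil => exact absurd rfl hv
      | cons hadj q =>
        rename_i w
        refine ⟨w, fun h => absurd h hv, fun _ => ⟨hadj, ?_⟩⟩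
        have h1 := SimpleGraph.dist_le q
        have h2 : H.dist v r ≤ H.dist w r + 1 := by
          obtain ⟨q', hq'⟩ := hH.connected.exists_walk_length_eq_dist w r
          have := SimpleGraph.dist_le (SimpleGraph.Walk.cons hadj q')
          simpa [hq'] using this
        simp only [SimpleGraph.Walk.length_cons] at hp
        omega
  choose f hf1 hf2 using hstep
  have hf : IsParentFun r f := by
    refine ⟨hf1 r rfl, ?_⟩
    have : ∀ n v, H.dist v r = n → ∃ k, f^[k] v = r := by
      intro n
      induction n with
      | zero =>
        intro v hv
        exact ⟨0, hH.connected.dist_eq_zero_iff.1 hv⟩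
      | succ n ih =>
        intro v hv
        have hvr : v ≠ r := by rintro rfl; simp at hv
        obtain ⟨k, hk⟩ := ih (f v) (by have := (hf2 v hvr).2; omega)
        exact ⟨k + 1, hk⟩
    exact fun v => this _ v rfl
  refine ⟨f, hf, fun v hv => (hf2 v hv).1, ?_⟩
  have hle : functionalGraph f ≤ H := functionalGraph_le hf.1 fun v hv => (hf2 v hv).1
  exact le_antisymm hle
    ((SimpleGraph.isTree_iff_minimal_connected.1 hH).2 hf.connected_functionalGraph hle)

theorem tau_eq_card_parentFun {V : Type} [Finite V] (G : SimpleGraph V) (r : V) :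
    tau G = Nat.card {f : V → V // IsParentFun r f ∧ ∀ v, v ≠ r → G.Adj v (f v)} := by
  refine (Nat.card_congr (Equiv.ofBijective (fun f => ⟨functionalGraph f.1,
    functionalGraph_le f.2.1.1 f.2.2, f.2.1.isTree_functionalGraph⟩) ⟨?_, ?_⟩)).symm
  · intro f g h
    exact Subtype.ext (f.2.1.ext_of_functionalGraph_eq g.2.1 (congrArg Subtype.val h))
  · rintro ⟨H, hHG, hH⟩
    obtain ⟨f, hf, hadj, rfl⟩ := hH.exists_isParentFun r
    exact ⟨⟨f, hf, fun v hv => hHG (hadj v hv)⟩, rfl⟩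

/-- The matrix-tree theorem. -/
theorem det_rootedLaplacian_eq_tau {V : Type} [Fintype V] [DecidableEq V] (G : SimpleGraph V)
    [DecidableRel G.Adj] (r : V) : (rootedLaplacian G r).det = tau G := by
  rw [det_rootedLaplacian, tau_eq_card_parentFun G r]

theorem tau_le_card_pow_card {V : Type} [Fintype V] [Nonempty V] (G : SimpleGraph V) :
    tau G ≤ Fintype.card V ^ Fintype.card V := by
  classical
  rw [tau_eq_card_parentFun G (Classical.arbitrary V), ← Fintype.card_fun,
    ← Nat.card_eq_fintype_card]
  exact Nat.card_le_card_of_injective _ Subtype.val_injective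

theorem SimpleGraph.Connected.tau_ne_zero {V : Type} [Finite V] {G : SimpleGraph V}
    (hG : G.Connected) : tau G ≠ 0 := by
  obtain ⟨T, hT, hT'⟩ := hG.exists_isTree_le
  have : Nonempty {H : SimpleGraph V // H ≤ G ∧ H.IsTree} := ⟨⟨T, hT, hT'⟩⟩
  exact Nat.card_pos.ne'

theorem SimpleGraph.Iso.tau_eq {V W : Type} {G : SimpleGraph V} {G' : SimpleGraph W}
    (e : G ≃g G') : tau G = tau G' := by
  refine Nat.card_congr (e.toEquiv.simpleGraph.subtypeEquiv fun H => and_congr ?_ ?_)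
  · constructor
    · intro h a b hab
      exact e.symm.map_adj_iff.1 (h hab)
    · intro h a b hab
      refine e.map_adj_iff.1 (h ?_)
      change H.Adj (e.toEquiv.symm (e.toEquiv a)) (e.toEquiv.symm (e.toEquiv b))
      simpa only [Equiv.symm_apply_apply] using hab
  · exact (SimpleGraph.Iso.comap e.toEquiv.symm H).isTree_iff.symm

/-- The tridiagonal matrix with diagonal `a` and off-diagonal entries `-1`. -/
def pathMatrix {m : ℕ} (a : Fin m → ℤ) : Matrix (Fin m) (Fin m) ℤ :=
  Matrix.of fun i j => if i = j then a i else if i.val + 1 = j ∨ j.val + 1 = i then -1 else 0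

theorem pathMatrix_submatrix_succ {m : ℕ} (a : Fin (m + 1) → ℤ) :
    (pathMatrix a).submatrix Fin.succ Fin.succ = pathMatrix (Fin.tail a) := by
  ext i j
  simp [pathMatrix, Fin.tail]

theorem det_pathMatrix_succ_succ {m : ℕ} (a : Fin (m + 2) → ℤ) :
    (pathMatrix a).det =
      a 0 * (pathMatrix (Fin.tail a)).det - (pathMatrix (Fin.tail (Fin.tail a))).det := by
  have h0 : (pathMatrix a).submatrix Fin.succ (Fin.succAbove 0) = pathMatrix (Fin.tail a) := by
    simpa using pathMatrix_submatrix_succ a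
  have h1 : ((pathMatrix a).submatrix Fin.succ (Fin.succAbove 1)).det =
      -(pathMatrix (Fin.tail (Fin.tail a))).det := by
    rw [Matrix.det_succ_column_zero, Fin.sum_univ_succ]
    have hz : ∀ i : Fin m, (pathMatrix a).submatrix Fin.succ (Fin.succAbove 1) i.succ 0 = 0 := by
      intro i
      simp [pathMatrix, Fin.ext_iff]
    have h2 : (pathMatrix a).submatrix Fin.succ (Fin.succAbove 1) 0 0 = -1 := by
      simp [pathMatrix, Fin.ext_iff]
    have h3 : ((pathMatrix a).submatrix Fin.succ (Fin.succAbove 1)).submatrix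
        (Fin.succAbove 0) Fin.succ = pathMatrix (Fin.tail (Fin.tail a)) := by
      rw [← pathMatrix_submatrix_succ, ← pathMatrix_submatrix_succ]
      ext i j
      simp [Fin.succAbove, Fin.lt_def]
    rw [h3, h2, Finset.sum_eq_zero fun i _ => by rw [hz, mul_zero, zero_mul]]
    simp
  rw [Matrix.det_succ_row_zero, Fin.sum_univ_succ, Fin.sum_univ_succ, Finset.sum_eq_zero]
  · rw [h0, Fin.succ_zero_eq_one, h1]
    simp [pathMatrix]
    ring
  · intro i _
    have : pathMatrix a 0 i.succ.succ = 0 := by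
      simp [pathMatrix, Fin.ext_iff]
    simp [this]

/-- The consecutive leading continuants of a sequence. -/
def continuantPair : (m : ℕ) → (Fin m → ℤ) → ℤ × ℤ
  | 0, _ => (1, 0)
  | m + 1, a => (a 0 * (continuantPair m (Fin.tail a)).1 - (continuantPair m (Fin.tail a)).2,
      (continuantPair m (Fin.tail a)).1)

theorem continuantPair_fst : ∀ {m : ℕ} (a : Fin m → ℤ),
    (continuantPair m a).1 = (pathMatrix a).det
  | 0, a => by simp [continuantPair]
  | 1, a => by simp [continuantPair, pathMatrix]
  | m + 2, a => by
    rw [det_pathMatrix_succ_succ, ← continuantPair_fst, ← continuantPair_fst]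
    rfl

theorem continuantPair_bounds {m : ℕ} {a : Fin m → ℤ} (ha : ∀ i, 2 ≤ a i) :
    0 ≤ (continuantPair m a).2 ∧ (continuantPair m a).2 < (continuantPair m a).1 := by
  induction m with
  | zero => simp [continuantPair]
  | succ m ih =>
    have h := ih (a := Fin.tail a) fun i => ha _
    have h0 := ha 0
    simp only [continuantPair]
    constructor <;> nlinarith

theorem continuantPair_injective {m : ℕ} {a b : Fin m → ℤ} (ha : ∀ i, 2 ≤ a i)
    (hb : ∀ i, 2 ≤ b i) (h : continuantPair m a = continuantPair m b) : a = b := by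
  induction m with
  | zero => exact Subsingleton.elim _ _
  | succ m ih =>
    have ha' := continuantPair_bounds (a := Fin.tail a) fun i => ha _
    have hb' := continuantPair_bounds (a := Fin.tail b) fun i => hb _
    simp only [continuantPair, Prod.mk.injEq] at h
    obtain ⟨h1, h2⟩ := h
    rw [← h2] at h1 hb'
    have h0 : a 0 = b 0 := by
      rcases lt_trichotomy (a 0) (b 0) with h | h | h
      · nlinarith
      · exact h
      · nlinarith
    have h3 : Fin.tail a = Fin.tail b := by
      refine ih (fun i => ha _) (fun i => hb _) (Prod.ext h2 ?_)
      rw [h0] at h1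
      linarith
    rw [← Fin.cons_self_tail a, ← Fin.cons_self_tail b, h0, h3]

/-- The determinants of the tridiagonal matrices whose diagonal entries lie in `[3, K + 3)`. -/
noncomputable def pathDetValues (K m : ℕ) : Finset ℤ :=
  Finset.univ.image fun b : Fin m → Fin K => (pathMatrix fun i => ((b i : ℕ) : ℤ) + 3).det

theorem pathDetValues_nonneg {K m : ℕ} {x : ℤ} (hx : x ∈ pathDetValues K m) : 0 ≤ x := by
  obtain ⟨b, -, rfl⟩ := Finset.mem_image.1 hx
  have := continuantPair_bounds (a := fun i => ((b i : ℕ) : ℤ) + 3) fun i => by omega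
  rw [← continuantPair_fst]
  omega

theorem pow_le_card_pathDetValues_mul (K m : ℕ) :
    K ^ (m + 1) ≤ (pathDetValues K (m + 1)).card * (pathDetValues K m).card := by
  rw [← Finset.card_product]
  calc K ^ (m + 1) = (Finset.univ : Finset (Fin (m + 1) → Fin K)).card := by simp
    _ ≤ _ := by
      refine Finset.card_le_card_of_injOn
        (fun b => continuantPair (m + 1) fun i => ((b i : ℕ) : ℤ) + 3) ?_ ?_
      · intro b _
        simp only [Finset.coe_product, Set.mem_prod, continuantPair_fst]
        refine ⟨Finset.mem_image_of_mem _ (Finset.mem_univ b), ?_⟩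
        simp only [continuantPair, continuantPair_fst]
        exact Finset.mem_image_of_mem _ (Finset.mem_univ (Fin.tail b))
      · intro b _ c _ h
        have := continuantPair_injective (fun i => by omega) (fun i => by omega) h
        funext i
        have hi : ((b i : ℕ) : ℤ) + 3 = ((c i : ℕ) : ℤ) + 3 := congrFun this i
        omega

theorem exists_pow_le_card_pathDetValues_sq (K m : ℕ) :
    ∃ k ≤ m, K ^ m ≤ (pathDetValues K k).card ^ 2 := by
  cases m with
  | zero => exact ⟨0, le_rfl, by simp [pathDetValues]⟩
  | succ m =>
    have h := pow_le_card_pathDetValues_mul K m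
    rcases le_total (pathDetValues K m).card (pathDetValues K (m + 1)).card with h' | h'
    · exact ⟨m + 1, le_rfl, h.trans (by rw [sq]; gcongr)⟩
    · exact ⟨m, by omega, h.trans (by rw [sq]; gcongr)⟩

theorem Matrix.fromCols_one_zero_mul_apply {α β γ R : Type*} [Fintype α] [DecidableEq α]
    [Fintype β] [Semiring R] (X : Matrix (α ⊕ β) γ R) (a : α) (c : γ) :
    ((Matrix.fromCols 1 0 : Matrix α (α ⊕ β) R) * X) a c = X (.inl a) c := by
  simp [Matrix.mul_apply, Matrix.one_apply]

/-- A row and column operation splitting off the antisymmetric part of a matrix in which the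
first block is a decoupled copy of the second. -/
theorem Matrix.det_dvd_det_of_twin_blocks {α β R : Type*} [Fintype α] [DecidableEq α] [Fintype β]
    [DecidableEq β] [CommRing R] (M : Matrix (α ⊕ (α ⊕ β)) (α ⊕ (α ⊕ β)) R)
    (h₁ : ∀ a a', M (.inl a) (.inr (.inl a')) = 0)
    (h₂ : ∀ a a', M (.inr (.inl a)) (.inl a') = 0)
    (h₃ : ∀ a a', M (.inr (.inl a)) (.inr (.inl a')) = M (.inl a) (.inl a'))
    (h₄ : ∀ a b, M (.inr (.inl a)) (.inr (.inr b)) = M (.inl a) (.inr (.inr b))) :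
    (Matrix.of fun a a' => M (.inl a) (.inl a')).det ∣ M.det := by
  let N : Matrix α (α ⊕ β) R := Matrix.fromCols 1 0
  let A : Matrix α α R := Matrix.of fun a a' => M (.inl a) (.inl a')
  have hM : M = Matrix.fromBlocks A M.toBlocks₁₂ M.toBlocks₂₁ M.toBlocks₂₂ :=
    (Matrix.fromBlocks_toBlocks M).symm
  have hrow : Matrix.fromBlocks 1 (-N) 0 1 * M =
      Matrix.fromBlocks A (-(A * N)) M.toBlocks₂₁ M.toBlocks₂₂ := by
    conv_lhs => rw [hM]
    rw [Matrix.fromBlocks_multiply]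
    congr 1
    · ext a a'
      rw [Matrix.one_mul, Matrix.neg_mul, Matrix.add_apply, Matrix.neg_apply,
        Matrix.fromCols_one_zero_mul_apply]
      simp [Matrix.toBlocks₂₁, h₂]
    · ext a (a' | b)
      · rw [Matrix.one_mul, Matrix.neg_mul, Matrix.add_apply, Matrix.neg_apply,
        Matrix.fromCols_one_zero_mul_apply]
        simp [Matrix.toBlocks₂₂, Matrix.toBlocks₁₂, h₁, h₃, N, A]
      · rw [Matrix.one_mul, Matrix.neg_mul, Matrix.add_apply, Matrix.neg_apply,
        Matrix.fromCols_one_zero_mul_apply]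
        simp [Matrix.toBlocks₂₂, Matrix.toBlocks₁₂, h₄, N]
    · simp
    · simp
  have hcol : Matrix.fromBlocks 1 (-N) 0 1 * M * Matrix.fromBlocks 1 N 0 1 =
      Matrix.fromBlocks A 0 M.toBlocks₂₁ (M.toBlocks₂₁ * N + M.toBlocks₂₂) := by
    rw [hrow, Matrix.fromBlocks_multiply]
    simp
  have hdet := congrArg Matrix.det hcol
  rw [Matrix.det_mul, Matrix.det_mul, Matrix.det_fromBlocks_zero₂₁, Matrix.det_fromBlocks_zero₂₁,
    Matrix.det_fromBlocks_zero₁₂] at hdet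
  simp only [Matrix.det_one, one_mul, mul_one] at hdet
  exact ⟨_, hdet⟩

/-- Two disjoint copies of `H` together with a clique `Fin (h + 1)`; both copies of a vertex `a` of
`H` are joined to the first `d a` vertices of the clique. -/
def twinGraph {α : Type*} (H : SimpleGraph α) (d : α → ℕ) (h : ℕ) :
    SimpleGraph (α ⊕ (α ⊕ Fin (h + 1))) where
  Adj
    | .inl a, .inl b => H.Adj a b
    | .inr (.inl a), .inr (.inl b) => H.Adj a b
    | .inl a, .inr (.inr j) => j.val < d a
    | .inr (.inr j), .inl a => j.val < d a
    | .inr (.inl a), .inr (.inr j) => j.val < d a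
    | .inr (.inr j), .inr (.inl a) => j.val < d a
    | .inr (.inr i), .inr (.inr j) => i ≠ j
    | .inl _, .inr (.inl _) => False
    | .inr (.inl _), .inl _ => False
  symm := ⟨by
    rintro (a | a | i) (b | b | j) hab
    all_goals first | exact hab | exact H.symm hab | exact hab.symm⟩
  loopless := ⟨by
    rintro (a | a | i) hab
    · exact H.irrefl hab
    · exact H.irrefl hab
    · exact hab rfl⟩

theorem connected_twinGraph {α : Type*} (H : SimpleGraph α) {d : α → ℕ} (hd : ∀ a, 1 ≤ d a)
    (h : ℕ) : (twinGraph H d h).Connected := by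
  have hall : ∀ v, (twinGraph H d h).Reachable v (.inr (.inr 0)) := by
    rintro (a | a | i)
    · exact SimpleGraph.Adj.reachable (hd a)
    · exact SimpleGraph.Adj.reachable (hd a)
    · by_cases hi : i = 0
      · rw [hi]
      · exact SimpleGraph.Adj.reachable hi
  have : Nonempty (α ⊕ (α ⊕ Fin (h + 1))) := ⟨.inr (.inr 0)⟩
  exact SimpleGraph.Connected.mk fun u v => (hall u).trans (hall v).symm

theorem rootedLaplacian_apply_of_ne {V : Type*} [Fintype V] [DecidableEq V] (G : SimpleGraph V)
    [DecidableRel G.Adj] {r v : V} (hv : v ≠ r) (u : V) :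
    rootedLaplacian G r v u = (if v = u then (G.degree v : ℤ) else 0) -
      if G.Adj v u then 1 else 0 := by
  rw [rootedLaplacian, Matrix.updateRow_ne hv, SimpleGraph.lapMatrix, SimpleGraph.degMatrix,
    Matrix.sub_apply, Matrix.diagonal_apply, SimpleGraph.adjMatrix_apply]

theorem det_dvd_tau_twinGraph {α : Type} [Fintype α] [DecidableEq α] (H : SimpleGraph α)
    [DecidableRel H.Adj] {d : α → ℕ} {h : ℕ} (hd : ∀ a, d a ≤ h + 1) :
    (H.lapMatrix ℤ + Matrix.diagonal fun a => (d a : ℤ)).det ∣ (tau (twinGraph H d h) : ℤ) := by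
  classical
  set G := twinGraph H d h
  have g₁ : ∀ a b, G.Adj (.inl a) (.inl b) ↔ H.Adj a b := fun _ _ => Iff.rfl
  have g₂ : ∀ a b, G.Adj (.inr (.inl a)) (.inr (.inl b)) ↔ H.Adj a b := fun _ _ => Iff.rfl
  have g₃ : ∀ a j, G.Adj (.inl a) (.inr (.inr j)) ↔ j.val < d a := fun _ _ => Iff.rfl
  have g₄ : ∀ a j, G.Adj (.inr (.inl a)) (.inr (.inr j)) ↔ j.val < d a := fun _ _ => Iff.rfl
  have g₅ : ∀ a b, G.Adj (.inl a) (.inr (.inl b)) ↔ False := fun _ _ => Iff.rfl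
  have g₆ : ∀ a b, G.Adj (.inr (.inl a)) (.inl b) ↔ False := fun _ _ => Iff.rfl
  have hsum : ∀ a, (∑ j : Fin (h + 1), if j.val < d a then (1 : ℤ) else 0) = d a := by
    intro a
    have := Fin.card_filter_val_lt (n := h + 1) (m := d a)
    rw [Finset.sum_boole, this, min_eq_right (hd a)]
  have hdeg : ∀ a, (G.degree (.inl a) : ℤ) = H.degree a + d a := by
    intro a
    rw [SimpleGraph.degree_eq_sum_if_adj, Fintype.sum_sum_type, Fintype.sum_sum_type,
      SimpleGraph.degree_eq_sum_if_adj]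
    simp only [g₁, g₃, g₅, if_false, Finset.sum_const_zero, hsum, zero_add]
  have hdeg' : ∀ a, (G.degree (.inr (.inl a)) : ℤ) = H.degree a + d a := by
    intro a
    rw [SimpleGraph.degree_eq_sum_if_adj, Fintype.sum_sum_type, Fintype.sum_sum_type,
      SimpleGraph.degree_eq_sum_if_adj]
    simp only [g₂, g₄, g₆, if_false, Finset.sum_const_zero, hsum, zero_add]
  have hl : ∀ a : α, (.inl a : α ⊕ (α ⊕ Fin (h + 1))) ≠ .inr (.inr 0) := by simp
  have hr : ∀ a : α, (.inr (.inl a) : α ⊕ (α ⊕ Fin (h + 1))) ≠ .inr (.inr 0) := by simp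
  rw [← det_rootedLaplacian_eq_tau G (.inr (.inr 0))]
  have key := Matrix.det_dvd_det_of_twin_blocks (rootedLaplacian G (.inr (.inr 0)))
    (fun a b => by simp [rootedLaplacian_apply_of_ne G (hl a), g₅])
    (fun a b => by simp [rootedLaplacian_apply_of_ne G (hr a), g₆])
    (fun a b => by
      simp [rootedLaplacian_apply_of_ne G (hl a), rootedLaplacian_apply_of_ne G (hr a), g₁, g₂,
        hdeg, hdeg'])
    (fun a j => by
      simp [rootedLaplacian_apply_of_ne G (hl a), rootedLaplacian_apply_of_ne G (hr a), g₃, g₄])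
  suffices hA : H.lapMatrix ℤ + Matrix.diagonal (fun a => (d a : ℤ)) = Matrix.of fun a b =>
      rootedLaplacian G (.inr (.inr 0)) (.inl a) (.inl b) by rwa [hA]
  ext a b
  rw [Matrix.of_apply, rootedLaplacian_apply_of_ne G (hl a), SimpleGraph.lapMatrix,
    SimpleGraph.degMatrix, Matrix.add_apply, Matrix.sub_apply, SimpleGraph.adjMatrix_apply]
  by_cases hab : a = b
  · subst hab
    simp [hdeg]
  · simp [g₁, hab]

theorem degree_pathGraph_le_two {k : ℕ} [DecidableRel (SimpleGraph.pathGraph k).Adj] (i : Fin k) :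
    (SimpleGraph.pathGraph k).degree i ≤ 2 := by
  classical
  have hsub : (SimpleGraph.pathGraph k).neighborFinset i ⊆
      (Finset.univ.filter fun j : Fin k => i.val + 1 = j) ∪
        Finset.univ.filter fun j : Fin k => j.val + 1 = i := by
    intro j hj
    simpa [SimpleGraph.pathGraph_adj] using hj
  refine (Finset.card_le_card hsub).trans ((Finset.card_union_le _ _).trans
    (Nat.add_le_add (Finset.card_le_one.2 ?_) (Finset.card_le_one.2 ?_)) : _ ≤ 1 + 1)
  all_goals
    intro a ha b hb
    simp only [Finset.mem_filter, Finset.mem_univ, true_and] at ha hb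
    omega

theorem tau_mem_treeSpectrum {V : Type} [Fintype V] {n : ℕ} (hn : Fintype.card V = n)
    (G : SimpleGraph V) : tau G ∈ treeSpectrum n := by
  let e := Fintype.equivFinOfCardEq hn
  exact ⟨G.map e.toEmbedding, (SimpleGraph.Iso.map e G).tau_eq.symm⟩

theorem exists_mem_treeSpectrum_dvd {K k n : ℕ} (hn : 2 * k + K + 2 ≤ n) {x : ℤ}
    (hx : x ∈ pathDetValues K k) : ∃ t ∈ treeSpectrum n, t ≠ 0 ∧ t ≤ n ^ n ∧ x ∣ (t : ℤ) := by
  classical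
  obtain ⟨b, -, rfl⟩ := Finset.mem_image.1 hx
  set d : Fin k → ℕ := fun i => b i + 3 - (SimpleGraph.pathGraph k).degree i with hd
  have hdeg : ∀ i, (SimpleGraph.pathGraph k).degree i ≤ 2 := degree_pathGraph_le_two
  obtain ⟨h, hh⟩ : ∃ h, n = 2 * k + (h + 1) := ⟨n - 2 * k - 1, by omega⟩
  have hcard : Fintype.card (Fin k ⊕ (Fin k ⊕ Fin (h + 1))) = n := by
    simp only [Fintype.card_sum, Fintype.card_fin]
    omega
  refine ⟨tau (twinGraph (SimpleGraph.pathGraph k) d h), tau_mem_treeSpectrum hcard _,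
    (connected_twinGraph _ (fun i => ?_) h).tau_ne_zero, ?_, ?_⟩
  · have := hdeg i
    simp only [hd]
    omega
  · have := tau_le_card_pow_card (twinGraph (SimpleGraph.pathGraph k) d h)
    rwa [hcard] at this
  · have key := det_dvd_tau_twinGraph (SimpleGraph.pathGraph k) (d := d) (h := h) fun i => by
      have := (b i).2
      simp only [hd]
      omega
    suffices hA : (SimpleGraph.pathGraph k).lapMatrix ℤ + Matrix.diagonal (fun a => (d a : ℤ)) =
        pathMatrix fun i => ((b i : ℕ) : ℤ) + 3 by rwa [hA] at key
    ext i j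
    by_cases hij : i = j
    · subst hij
      have := hdeg i
      simp [pathMatrix, SimpleGraph.lapMatrix, SimpleGraph.degMatrix, hd]
      omega
    · simp only [pathMatrix, SimpleGraph.lapMatrix, SimpleGraph.degMatrix, Matrix.of_apply, hij,
        if_false, Matrix.add_apply, Matrix.sub_apply, Matrix.diagonal_apply_ne _ hij,
        SimpleGraph.adjMatrix_apply, SimpleGraph.pathGraph_adj]
      split_ifs <;> simp

theorem finite_treeSpectrum (n : ℕ) : (treeSpectrum n).Finite :=
  Set.finite_range _

theorem card_pathDetValues_le {K k n : ℕ} (hn : 2 * k + K + 2 ≤ n) {ε C : ℝ} (hε : 0 < ε)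
    (hC1 : 1 ≤ C) (hC : ∀ t : ℕ, t ≠ 0 → (t.divisors.card : ℝ) ≤ C * (t : ℝ) ^ ε) :
    ((pathDetValues K k).card : ℝ) ≤
      (treeSpectrum n).ncard * (C * ((n ^ n : ℕ) : ℝ) ^ ε) := by
  classical
  set S : Finset ℕ := (finite_treeSpectrum n).toFinset.filter fun t => t ≠ 0 ∧ t ≤ n ^ n with hS
  have hScard : (S.card : ℝ) ≤ (treeSpectrum n).ncard := by
    rw [Set.ncard_eq_toFinset_card _ (finite_treeSpectrum n)]
    exact_mod_cast Finset.card_filter_le _ _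
  have hinj : Set.InjOn Int.natAbs (pathDetValues K k) := by
    intro x hx y hy hxy
    have := pathDetValues_nonneg hx
    have := pathDetValues_nonneg hy
    omega
  have hsub : (pathDetValues K k).image Int.natAbs ⊆ S.biUnion Nat.divisors := by
    intro y hy
    obtain ⟨x, hx, rfl⟩ := Finset.mem_image.1 hy
    obtain ⟨t, ht, ht0, htn, hdvd⟩ := exists_mem_treeSpectrum_dvd hn hx
    refine Finset.mem_biUnion.2 ⟨t, by simp [hS, ht, ht0, htn], ?_⟩
    exact Nat.mem_divisors.2 ⟨Int.natCast_dvd_natCast.1 (Int.natAbs_dvd.2 hdvd), ht0⟩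
  calc ((pathDetValues K k).card : ℝ) = ((pathDetValues K k).image Int.natAbs).card := by
        rw [Finset.card_image_of_injOn hinj]
    _ ≤ ((S.biUnion Nat.divisors).card : ℝ) := by exact_mod_cast Finset.card_le_card hsub
    _ ≤ ∑ t ∈ S, (t.divisors.card : ℝ) := by exact_mod_cast Finset.card_biUnion_le
    _ ≤ ∑ _t ∈ S, C * ((n ^ n : ℕ) : ℝ) ^ ε := by
        refine Finset.sum_le_sum fun t ht => ?_
        obtain ⟨-, ht0, htn⟩ := Finset.mem_filter.1 ht
        refine (hC t ht0).trans ?_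
        gcongr
    _ = S.card * (C * ((n ^ n : ℕ) : ℝ) ^ ε) := by rw [Finset.sum_const, nsmul_eq_mul]
    _ ≤ _ := by gcongr

theorem Nat.exists_card_divisors_le_mul_rpow {ε : ℝ} (hε : 0 < ε) :
    ∃ C : ℝ, 1 ≤ C ∧ ∀ t : ℕ, t ≠ 0 → (t.divisors.card : ℝ) ≤ C * (t : ℝ) ^ ε := by
  have hl : 0 < Real.log 2 := Real.log_pos (by norm_num)
  set B : ℝ := 1 + 1 / (ε * Real.log 2) with hB
  have hB1 : 1 ≤ B := by
    have : 0 < 1 / (ε * Real.log 2) := by positivity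
    rw [hB]
    linarith
  obtain ⟨P, hP⟩ := exists_nat_ge ((2 : ℝ) ^ (1 / ε))
  refine ⟨B ^ P, one_le_pow₀ hB1, fun t ht => ?_⟩
  have hfac : ∀ p ∈ t.primeFactors, ((t.factorization p + 1 : ℕ) : ℝ) ≤
      (if p < P then B else 1) * ((p : ℝ) ^ t.factorization p) ^ ε := by
    intro p hp
    have hp2 : (2 : ℝ) ≤ p := by exact_mod_cast (Nat.prime_of_mem_primeFactors hp).two_le
    set e := t.factorization p
    rw [← Real.rpow_natCast_mul (by positivity)]
    split_ifs with h
    · have h1 : 1 + e * ε * Real.log 2 ≤ (p : ℝ) ^ ((e : ℝ) * ε) := by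
        calc 1 + e * ε * Real.log 2 ≤ Real.exp (e * ε * Real.log 2) := by
              linarith [Real.add_one_le_exp (e * ε * Real.log 2)]
          _ = (2 : ℝ) ^ ((e : ℝ) * ε) := by
              rw [Real.rpow_def_of_pos (by norm_num), mul_comm]
          _ ≤ _ := Real.rpow_le_rpow (by norm_num) hp2 (by positivity)
      calc ((e + 1 : ℕ) : ℝ) ≤ B * (1 + e * ε * Real.log 2) := by
            rw [hB]; push_cast; field_simp
            have : 0 ≤ ε * Real.log 2 := by positivity
            have h3 : 0 ≤ (e : ℝ) := by positivity
            nlinarith [mul_nonneg h3 (mul_nonneg this this)]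
        _ ≤ _ := by gcongr
    · rw [one_mul, mul_comm, Real.rpow_mul (by positivity), Real.rpow_natCast]
      have h2 : (2 : ℝ) ≤ (p : ℝ) ^ ε := by
        calc (2 : ℝ) = ((2 : ℝ) ^ (1 / ε)) ^ ε := by
              rw [← Real.rpow_mul (by norm_num), one_div_mul_cancel hε.ne', Real.rpow_one]
          _ ≤ (p : ℝ) ^ ε := by
              refine Real.rpow_le_rpow (by positivity) (hP.trans ?_) hε.le
              exact_mod_cast not_lt.1 h
      calc ((e + 1 : ℕ) : ℝ) ≤ ((2 ^ e : ℕ) : ℝ) := by exact_mod_cast Nat.lt_two_pow_self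
        _ = (2 : ℝ) ^ e := by push_cast; rfl
        _ ≤ _ := by gcongr
  rw [Nat.card_divisors ht, Nat.cast_prod]
  refine (Finset.prod_le_prod (fun _ _ => by positivity) hfac).trans ?_
  rw [Finset.prod_mul_distrib, Real.finsetProd_rpow _ _ (fun _ _ => by positivity)]
  have ht' : ∏ p ∈ t.primeFactors, (p : ℝ) ^ t.factorization p = t := by
    exact_mod_cast Nat.prod_factorization_pow_eq_self ht
  rw [ht']
  gcongr
  rw [← Finset.prod_filter, Finset.prod_const]
  refine pow_le_pow_right₀ hB1 ?_
  calc _ ≤ (Finset.range P).card := Finset.card_le_card fun p hp => by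
        simpa using (Finset.mem_filter.1 hp).2
    _ = P := Finset.card_range P

theorem mul_log_le_log_ncard_treeSpectrum {n K m : ℕ} (hK : 0 < K) (hn : 2 * m + K + 2 ≤ n)
    {ε C : ℝ} (hC1 : 1 ≤ C)
    (hC : ∀ t : ℕ, t ≠ 0 → (t.divisors.card : ℝ) ≤ C * (t : ℝ) ^ ε) (hε : 0 < ε) :
    0 < (treeSpectrum n).ncard ∧ m * Real.log K ≤
      2 * (Real.log (treeSpectrum n).ncard + Real.log C + ε * (n * Real.log n)) := by
  obtain ⟨k, hkm, hk⟩ := exists_pow_le_card_pathDetValues_sq K m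
  have hle := card_pathDetValues_le (K := K) (k := k) (n := n) (by omega) hε hC1 hC
  have hn0 : 0 < n := by omega
  have hn0' : (0 : ℝ) < n := by exact_mod_cast hn0
  have hD : 0 < C * ((n ^ n : ℕ) : ℝ) ^ ε := by positivity
  have hKm : 0 < (K : ℝ) ^ m := by positivity
  have hk' : (K : ℝ) ^ m ≤ ((treeSpectrum n).ncard * (C * ((n ^ n : ℕ) : ℝ) ^ ε)) ^ 2 := by
    calc (K : ℝ) ^ m ≤ ((pathDetValues K k).card : ℝ) ^ 2 := by exact_mod_cast hk
      _ ≤ _ := by gcongr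
  have hpos : 0 < (treeSpectrum n).ncard := by
    refine Nat.pos_of_ne_zero fun h0 => ?_
    rw [h0] at hk'
    simp only [Nat.cast_zero, zero_mul, ne_eq, OfNat.ofNat_ne_zero, not_false_eq_true,
      zero_pow] at hk'
    exact hk'.not_gt hKm
  have hpos' : (0 : ℝ) < (treeSpectrum n).ncard := by exact_mod_cast hpos
  refine ⟨hpos, ?_⟩
  have hlog := Real.log_le_log hKm hk'
  have hpow : (0 : ℝ) < ((n ^ n : ℕ) : ℝ) := by positivity
  rw [Real.log_pow, Real.log_pow, Real.log_mul hpos'.ne' hD.ne',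
    Real.log_mul (by positivity) (by positivity), Real.log_rpow hpow, Nat.cast_pow,
    Real.log_pow] at hlog
  push_cast at hlog
  linarith

theorem tree_spectrum_lower_bound (c : ℝ) (hc0 : 0 < c) (hc1 : c < 1 / 4) :
    ∃ n₀ : ℕ, ∀ n : ℕ, n₀ ≤ n →
      Real.exp (c * n * Real.log n) ≤ (Set.ncard (treeSpectrum n) : ℝ) := by
  obtain ⟨δ, hδ⟩ : ∃ δ : ℝ, δ = (1 / 4 - c) * (2 / 5) := ⟨_, rfl⟩
  have hδ0 : 0 < δ := by rw [hδ]; linarith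
  have hδ1 : δ < 1 := by rw [hδ]; linarith
  obtain ⟨C, hC1, hC⟩ := Nat.exists_card_divisors_le_mul_rpow hδ0
  have hcast := tendsto_natCast_atTop_atTop (R := ℝ)
  have e1 : ∀ᶠ n : ℕ in Filter.atTop, (n : ℝ) ^ (1 - δ) ≤ δ / 2 * n := by
    filter_upwards [hcast.eventually ((tendsto_rpow_neg_atTop hδ0).eventually_le_const
      (half_pos hδ0)), Filter.eventually_gt_atTop 0] with n hn h0
    have h0' : (0 : ℝ) < n := by exact_mod_cast h0
    rw [sub_eq_add_neg, Real.rpow_add h0', Real.rpow_one, mul_comm]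
    exact mul_le_mul_of_nonneg_right hn h0'.le
  have e2 : ∀ᶠ n : ℕ in Filter.atTop, 4 ≤ δ / 2 * n :=
    (hcast.const_mul_atTop (half_pos hδ0)).eventually_ge_atTop 4
  have e3 : ∀ᶠ n : ℕ in Filter.atTop, Real.log C ≤ δ * n :=
    (hcast.const_mul_atTop hδ0).eventually_ge_atTop _
  have e4 : ∀ᶠ n : ℕ in Filter.atTop, 1 ≤ Real.log n :=
    (Real.tendsto_log_atTop.comp hcast).eventually_ge_atTop 1
  obtain ⟨n₀, hn₀⟩ := Filter.eventually_atTop.1 (e1.and (e2.and (e3.and e4)))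
  refine ⟨n₀, fun n hn => ?_⟩
  obtain ⟨h1, h2, h3, h4⟩ := hn₀ n hn
  have hn0 : (0 : ℝ) < n := by
    by_contra! h
    nlinarith
  have hroot : 0 < (n : ℝ) ^ (1 - δ) := by positivity
  set K := ⌈(n : ℝ) ^ (1 - δ)⌉₊
  have hK : 0 < K := Nat.ceil_pos.2 hroot
  have hKle : (n : ℝ) ^ (1 - δ) ≤ K := Nat.le_ceil _
  have hKlt : (K : ℝ) < (n : ℝ) ^ (1 - δ) + 1 := Nat.ceil_lt_add_one hroot.le
  have hKn : K + 3 ≤ n := by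
    have : (K : ℝ) + 3 ≤ n := by nlinarith
    exact_mod_cast this
  obtain ⟨m, hm⟩ : ∃ m, m = (n - K - 2) / 2 := ⟨_, rfl⟩
  have hm2 : n ≤ 2 * m + K + 3 := by omega
  have hm' : (1 - δ) * n / 2 ≤ m := by
    have : (n : ℝ) ≤ 2 * m + K + 3 := by exact_mod_cast hm2
    linarith
  have hlogK : (1 - δ) * Real.log n ≤ Real.log K := by
    rw [← Real.log_rpow hn0]
    exact Real.log_le_log hroot hKle
  obtain ⟨hpos, hmain⟩ :=
    mul_log_le_log_ncard_treeSpectrum hK (show 2 * m + K + 2 ≤ n by omega) hC1 hC hδ0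
  rw [← Real.le_log_iff_exp_le (by exact_mod_cast hpos)]
  have hprod : (1 - δ) * n / 2 * ((1 - δ) * Real.log n) ≤ m * Real.log K :=
    mul_le_mul hm' hlogK (mul_nonneg (by linarith) (by linarith)) (by positivity)
  have hnl : 0 < n * Real.log n := by positivity
  have hCn : Real.log C ≤ δ * (n * Real.log n) := by nlinarith [mul_pos hδ0 hn0]
  have hsq : (1 - 2 * δ) * (n * Real.log n) ≤ (1 - δ) ^ 2 * (n * Real.log n) :=
    mul_le_mul_of_nonneg_right (by nlinarith) hnl.le
  have hc : c * (n * Real.log n) = (1 / 4 - 5 / 2 * δ) * (n * Real.log n) := by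
    rw [hδ]; ring
  nlinarith
end

section
/- Fix a real number η > 0. There exists C such that for all integers m ≥ 3 and q ≥ 1 with m + q ≥ C, the number of distinct values of τ(G_w), as w ranges over {2,3,…,q+1}^m, is at least q^m / ( (q+1)^{2ηm} · N^{ηN} ), where N = 4m + q − 1. -/
/-- Vertices of the graph `G_w`: a root `ρ`, anchor vertices `a₁,…,a_q`,
and four paths `u₁−⋯−u_m`, `v₁−⋯−v_m`, `u′₁−⋯−u′_{m−1}`, `v′₁−⋯−v′_{m−1}`. -/
inductive Vert (m q : ℕ) : Type
  | rho : Vert m q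
  | anchor : Fin q → Vert m q
  | u : Fin m → Vert m q
  | v : Fin m → Vert m q
  | u' : Fin (m - 1) → Vert m q
  | v' : Fin (m - 1) → Vert m q

/-- `pathDeg r pos = δ_pos^{(r)}`, the degree of vertex `pos` in the path on
`r` vertices (positions numbered `1,…,r`). -/
def pathDeg (r pos : ℕ) : ℕ :=
  (if 1 < pos then 1 else 0) + (if pos < r then 1 else 0)

/-- The defining edge relation of `G_w` (before symmetrization).
A vertex `Vert.u i` with `i : Fin m` represents `u_{i+1}` (position `i+1 ∈ {1,…,m}`),
and similarly for the other paths and anchors. -/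
def edgeRel (m q : ℕ) (w : ℕ → ℕ) : Vert m q → Vert m q → Prop
  | .rho, .anchor _ => True
  | .u i, .u j => (j : ℕ) = (i : ℕ) + 1
  | .v i, .v j => (j : ℕ) = (i : ℕ) + 1
  | .u' i, .u' j => (j : ℕ) = (i : ℕ) + 1
  | .v' i, .v' j => (j : ℕ) = (i : ℕ) + 1
  | .u i, .anchor t => (t : ℕ) < w ((i : ℕ) + 1) - pathDeg m ((i : ℕ) + 1)
  | .v i, .anchor t => (t : ℕ) < w ((i : ℕ) + 1) - pathDeg m ((i : ℕ) + 1)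
  | .u' i, .anchor t => (t : ℕ) < w ((i : ℕ) + 1) - pathDeg (m - 1) ((i : ℕ) + 1)
  | .v' i, .anchor t => (t : ℕ) < w ((i : ℕ) + 1) - pathDeg (m - 1) ((i : ℕ) + 1)
  | _, _ => False

/-- The simple graph `G_w`. -/
def Gw (m q : ℕ) (w : ℕ → ℕ) : SimpleGraph (Vert m q) :=
  SimpleGraph.fromRel (edgeRel m q w)

section MatrixTree
open Finset

variable {V : Type*} {ρ : V} {f g : V → V}

/-- Every vertex reaches the root `ρ` under iteration of the parent map `f`. -/
def ReachesRoot (ρ : V) (f : V → V) : Prop :=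
  ∀ v, ∃ k, f^[k] v = ρ

theorem ReachesRoot.exists_depth (hf : ReachesRoot ρ f) :
    ∃ d : V → ℕ, ∀ v, v ≠ ρ → d (f v) < d v := by
  classical
  refine ⟨fun v => Nat.find (hf v), fun v hv => ?_⟩
  have hspec := Nat.find_spec (hf v)
  rcases hk : Nat.find (hf v) with _ | k
  · rw [hk] at hspec
    exact absurd hspec hv
  · rw [hk, Function.iterate_succ_apply] at hspec
    simp only [hk]
    exact Nat.lt_succ_of_le (Nat.find_min' (hf (f v)) hspec)

theorem reachesRoot_of_depth {d : V → ℕ} (hd : ∀ v, v ≠ ρ → d (f v) < d v) :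
    ReachesRoot ρ f := by
  intro v
  induction hn : d v using Nat.strong_induction_on generalizing v with
  | _ n ih =>
    by_cases hv : v = ρ
    · exact ⟨0, hv⟩
    · obtain ⟨k, hk⟩ := ih (d (f v)) (hn ▸ hd v hv) (f v) rfl
      exact ⟨k + 1, by rwa [Function.iterate_succ_apply]⟩

/-- The graph joining every non-root vertex `v` to its parent `f v`. -/
def parentGraph (ρ : V) (f : V → V) : SimpleGraph V :=
  SimpleGraph.fromRel fun v w => v ≠ ρ ∧ f v = w

theorem parentGraph_adj_parent {d : V → ℕ} (hd : ∀ v, v ≠ ρ → d (f v) < d v) {v : V}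
    (hv : v ≠ ρ) : (parentGraph ρ f).Adj v (f v) := by
  rw [parentGraph, SimpleGraph.fromRel_adj]
  refine ⟨fun h => ?_, Or.inl ⟨hv, rfl⟩⟩
  have := hd v hv
  rw [← h] at this
  exact lt_irrefl _ this

theorem parentGraph_connected {d : V → ℕ} (hd : ∀ v, v ≠ ρ → d (f v) < d v) :
    (parentGraph ρ f).Connected := by
  rw [SimpleGraph.connected_iff_exists_forall_reachable]
  refine ⟨ρ, fun v => SimpleGraph.Reachable.symm ?_⟩
  induction hn : d v using Nat.strong_induction_on generalizing v with
  | _ n ih =>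
    by_cases hv : v = ρ
    · rw [hv]
    · exact (parentGraph_adj_parent hd hv).reachable.trans (ih _ (hn ▸ hd v hv) _ rfl)

theorem parentGraph_isTree [Finite V] (hf : ReachesRoot ρ f) : (parentGraph ρ f).IsTree := by
  classical
  obtain ⟨d, hd⟩ := hf.exists_depth
  have := Fintype.ofFinite V
  rw [SimpleGraph.isTree_iff_connected_and_card]
  have hconn := parentGraph_connected hd
  refine ⟨hconn, le_antisymm ?_ hconn.card_vert_le_card_edgeSet_add_one⟩
  have hsub : (parentGraph ρ f).edgeSet ⊆
      ↑((univ.erase ρ).image fun v => s(v, f v)) := by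
    intro e
    induction e with
    | _ a b =>
      rw [SimpleGraph.mem_edgeSet, parentGraph, SimpleGraph.fromRel_adj]
      rintro ⟨-, ⟨h, rfl⟩ | ⟨h, rfl⟩⟩
      · simp only [coe_image, Set.mem_image]
        exact ⟨a, by simpa using h, rfl⟩
      · simp only [coe_image, Set.mem_image]
        exact ⟨b, by simpa using h, Sym2.eq_swap⟩
  have h1 : Nat.card (parentGraph ρ f).edgeSet ≤ #(univ.erase ρ) := by
    refine (Nat.card_mono (Finset.finite_toSet _) hsub).trans ?_
    rw [Nat.card_eq_card_toFinset, toFinset_coe]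
    exact card_image_le
  have h2 : 0 < Fintype.card V := Fintype.card_pos_iff.2 ⟨ρ⟩
  rw [card_erase_of_mem (mem_univ _), card_univ] at h1
  rw [Nat.card_eq_fintype_card (α := V)]
  omega

theorem eq_of_parentGraph_eq (hf : ReachesRoot ρ f) (hρ : f ρ = g ρ)
    (h : parentGraph ρ f = parentGraph ρ g) : f = g := by
  obtain ⟨d, hd⟩ := hf.exists_depth
  funext v
  induction hn : d v using Nat.strong_induction_on generalizing v with
  | _ n ih =>
    by_cases hv : v = ρ
    · rw [hv, hρ]
    · have hlt := hd v hv
      have ih' := ih _ (hn ▸ hlt) (f v) rfl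
      have hadj := parentGraph_adj_parent hd hv
      rw [h, parentGraph, SimpleGraph.fromRel_adj] at hadj
      rcases hadj.2 with ⟨-, h1⟩ | ⟨h1, h2⟩
      · exact h1.symm
      · have := hd _ h1
        rw [ih', h2] at this
        exact absurd hlt this.not_gt

theorem exists_parentGraph_eq [Finite V] {H : SimpleGraph V} (hH : H.IsTree) (ρ : V) :
    ∃ f, f ρ = ρ ∧ (∀ v, v ≠ ρ → H.Adj v (f v)) ∧ ReachesRoot ρ f ∧ parentGraph ρ f = H := by
  classical
  have hstep : ∀ v, v ≠ ρ → ∃ w, H.Adj v w ∧ H.dist w ρ < H.dist v ρ := by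
    intro v hv
    obtain ⟨p, hp⟩ := hH.connected.exists_walk_length_eq_dist v ρ
    cases p with
    | nil => exact absurd rfl hv
    | cons hadj q =>
      refine ⟨_, hadj, ?_⟩
      rw [← hp, SimpleGraph.Walk.length_cons]
      exact Nat.lt_succ_of_le (SimpleGraph.dist_le q)
  choose! f hf using hstep
  have hd : ∀ v, v ≠ ρ → H.dist (Function.update f ρ ρ v) ρ < H.dist v ρ := fun v hv => by
    rw [Function.update_of_ne hv]
    exact (hf v hv).2
  have hadj : ∀ v, v ≠ ρ → H.Adj v (Function.update f ρ ρ v) := fun v hv => by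
    rw [Function.update_of_ne hv]
    exact (hf v hv).1
  refine ⟨Function.update f ρ ρ, Function.update_self .., hadj,
    reachesRoot_of_depth (d := fun v => H.dist v ρ) hd, ?_⟩
  have hle : parentGraph ρ (Function.update f ρ ρ) ≤ H := by
    intro a b
    rw [parentGraph, SimpleGraph.fromRel_adj]
    rintro ⟨-, ⟨h, rfl⟩ | ⟨h, rfl⟩⟩
    · exact hadj a h
    · exact (hadj b h).symm
  exact le_antisymm hle ((SimpleGraph.isTree_iff_minimal_connected.1 hH).2
    (parentGraph_connected (d := fun v => H.dist v ρ) hd) hle)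

variable [DecidableEq V]

/-- The row of index `v` in the reduced Laplacian of the graph `parentGraph ρ f`, when `f v = w`. -/
def parentRow (ρ v w : V) : V → ℤ :=
  if v = ρ then Pi.single v 1 else Pi.single v 1 - Pi.single w 1

variable [Fintype V]

theorem det_parentRow_of_reachesRoot (hf : ReachesRoot ρ f) :
    (Matrix.of fun v => parentRow ρ v (f v)).det = 1 := by
  obtain ⟨d, hd⟩ := hf.exists_depth
  have htri : (Matrix.of fun v => parentRow ρ v (f v)).BlockTriangular
      (OrderDual.toDual ∘ d) := by
    intro i j hij
    have hij' : d i < d j := hij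
    have h1 : j ≠ i := by rintro rfl; exact lt_irrefl _ hij'
    by_cases hi : i = ρ
    · simp [parentRow, hi, show j ≠ ρ from hi ▸ h1]
    · have h2 : j ≠ f i := by
        rintro rfl
        exact lt_asymm hij' (hd i hi)
      simp [parentRow, hi, h1, h2]
  rw [htri.det]
  refine prod_eq_one fun a _ => ?_
  suffices h : (Matrix.of fun v => parentRow ρ v (f v)).toSquareBlock
      (OrderDual.toDual ∘ d) a = 1 by rw [h, Matrix.det_one]
  ext ⟨i, hi⟩ ⟨j, hj⟩
  have hij : d i = d j := OrderDual.toDual.injective (hi.trans hj.symm)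
  have h2 : i ≠ ρ → j ≠ f i := by
    rintro h rfl
    exact (hd i h).ne' hij
  by_cases h1 : i = ρ
  · simp [parentRow, h1, Matrix.toSquareBlock_def, Matrix.one_apply, Pi.single_apply, eq_comm]
  · simp [parentRow, h1, Matrix.toSquareBlock_def, Matrix.one_apply, Pi.single_apply, h2 h1,
      @eq_comm _ i j]

theorem det_parentRow_of_not_reachesRoot (hρ : f ρ = ρ) (hf : ¬ ReachesRoot ρ f) :
    (Matrix.of fun v => parentRow ρ v (f v)).det = 0 := by
  classical
  rw [← Matrix.exists_mulVec_eq_zero_iff]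
  refine ⟨fun v => if ∃ k, f^[k] v = ρ then 0 else 1, fun h => hf fun v => ?_, ?_⟩
  · by_contra hv
    simpa [hv] using congrFun h v
  · have hiff : ∀ v, (∃ k, f^[k] (f v) = ρ) ↔ ∃ k, f^[k] v = ρ := by
      refine fun v => ⟨fun ⟨k, hk⟩ => ⟨k + 1, hk⟩, fun ⟨k, hk⟩ => ⟨k, ?_⟩⟩
      rw [← Function.iterate_succ_apply, Function.iterate_succ_apply', hk, hρ]
    ext v
    by_cases hv : v = ρ
    · have : ∃ k, f^[k] ρ = ρ := ⟨0, rfl⟩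
      simp [Matrix.mulVec, parentRow, hv, this]
    · have hrow : (fun j => (Matrix.of fun v => parentRow ρ v (f v)) v j) =
          Pi.single v 1 - Pi.single (f v) 1 := by
        ext j
        simp [parentRow, hv]
      simp only [Matrix.mulVec, hrow, sub_dotProduct, single_dotProduct, hiff v]
      simp

variable (G : SimpleGraph V) [DecidableRel G.Adj]

/-- The Laplacian matrix of `G` with the row of the root `ρ` replaced by a unit vector. -/
def rootedLap (ρ : V) : Matrix V V ℤ :=
  Matrix.of fun v w =>
    if v = ρ then (if w = v then 1 else 0)
    else (if w = v then (G.degree v : ℤ) else 0) - if G.Adj v w then 1 else 0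

/-- The possible parents of a vertex in a spanning tree rooted at `ρ`. -/
def parentChoices (ρ v : V) : Finset V :=
  if v = ρ then {ρ} else G.neighborFinset v

theorem det_rootedLap_eq_sum (ρ : V) :
    (rootedLap G ρ).det = ∑ f ∈ Fintype.piFinset (parentChoices G ρ),
      (Matrix.of fun v => parentRow ρ v (f v)).det := by
  have h : (rootedLap G ρ) = Matrix.of fun v => ∑ w ∈ parentChoices G ρ v, parentRow ρ v w := by
    ext v w
    by_cases hv : v = ρ
    · simp [rootedLap, parentChoices, parentRow, hv, Pi.single_apply]
    · simp [rootedLap, parentChoices, parentRow, hv, Pi.single_apply, Finset.sum_apply]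
  rw [h]
  exact (Matrix.detRowAlternating (R := ℤ) (n := V)).toMultilinearMap.map_sum_finset
    (fun v w => parentRow ρ v w) (parentChoices G ρ)

/-- Spanning trees correspond to parent functions. -/
theorem card_isTree_eq_card_parent (ρ : V) [DecidablePred (ReachesRoot ρ)] :
    Nat.card {H : SimpleGraph V // H ≤ G ∧ H.IsTree} =
      #{f ∈ Fintype.piFinset (parentChoices G ρ) | ReachesRoot ρ f} := by
  have hmem : ∀ f : V → V, f ∈ Fintype.piFinset (parentChoices G ρ) ↔
      f ρ = ρ ∧ ∀ v, v ≠ ρ → G.Adj v (f v) := by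
    intro f
    rw [Fintype.mem_piFinset]
    refine ⟨fun h => ⟨by simpa [parentChoices] using h ρ, fun v hv => ?_⟩, fun h v => ?_⟩
    · simpa [parentChoices, hv] using h v
    · by_cases hv : v = ρ
      · simp [parentChoices, hv, h.1]
      · simpa [parentChoices, hv] using h.2 v hv
  rw [← Fintype.card_coe, ← Nat.card_eq_fintype_card]
  symm
  refine Nat.card_eq_of_bijective (fun f => ⟨parentGraph ρ f.1, ?_,
    parentGraph_isTree (mem_filter.1 f.2).2⟩) ⟨fun f g h => ?_, fun ⟨H, hle, hH⟩ => ?_⟩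
  · have hf := ((hmem _).1 (mem_filter.1 f.2).1).2
    intro a b
    rw [parentGraph, SimpleGraph.fromRel_adj]
    rintro ⟨-, ⟨h, h'⟩ | ⟨h, h'⟩⟩
    · exact h' ▸ hf a h
    · exact h' ▸ (hf b h).symm
  · have hf := mem_filter.1 f.2
    have hg := mem_filter.1 g.2
    exact Subtype.ext (eq_of_parentGraph_eq hf.2
      (((hmem _).1 hf.1).1.trans ((hmem _).1 hg.1).1.symm) (Subtype.ext_iff.1 h))
  · obtain ⟨f, hρ, hadj, hf, rfl⟩ := exists_parentGraph_eq hH ρ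
    exact ⟨⟨f, mem_filter.2 ⟨(hmem f).2 ⟨hρ, fun v hv => hle (hadj v hv)⟩, hf⟩⟩, rfl⟩

/-- A graph on `n` vertices has at most `n ^ n` spanning trees. -/
theorem card_isTree_le (ρ : V) :
    Nat.card {H : SimpleGraph V // H ≤ G ∧ H.IsTree} ≤ Fintype.card V ^ Fintype.card V := by
  classical
  rw [card_isTree_eq_card_parent G ρ, ← Fintype.card_fun]
  exact card_le_univ _

/-- **Matrix-tree theorem**. -/
theorem det_rootedLap (ρ : V) :
    (rootedLap G ρ).det = Nat.card {H : SimpleGraph V // H ≤ G ∧ H.IsTree} := by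
  classical
  rw [det_rootedLap_eq_sum, card_isTree_eq_card_parent, card_filter, Nat.cast_sum]
  refine sum_congr rfl fun f hf => ?_
  have hρ : f ρ = ρ := by
    simpa [parentChoices] using Fintype.mem_piFinset.1 hf ρ
  split_ifs with h
  · exact det_parentRow_of_reachesRoot h
  · exact det_parentRow_of_not_reachesRoot hρ h

end MatrixTree

section SwapSymmetry

variable {V ι R : Type*} [Fintype V] [DecidableEq V] [Fintype ι] [DecidableEq ι] [CommRing R]

/-- If `σ` is an involutive symmetry of the matrix `A` moving exactly the indices in a set `S` and
in its image, and `A` has no entries between `S` and `σ S`, then the antisymmetric vectors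
form an invariant complement on which `A` acts as its principal submatrix on `S`. -/
theorem det_submatrix_dvd_det_of_involutive (A : Matrix V V R) {σ : V → V}
    (hσ : Function.Involutive σ) (hA : ∀ x y, A (σ x) (σ y) = A x y) {a : ι → V}
    (ha : Function.Injective a) (hdisj : ∀ i j, a i ≠ σ (a j))
    (hfix : ∀ x, x ∉ Set.range a → σ x ∉ Set.range a → σ x = x)
    (hzero : ∀ i j, A (a i) (σ (a j)) = 0) :
    (A.submatrix a a).det ∣ A.det := by
  classical
  set p : V → Prop := fun x => x ∈ Set.range a
  have hpσ : ∀ x, p x → ¬ p (σ x) := by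
    rintro _ ⟨i, rfl⟩ ⟨j, hj⟩
    exact hdisj j i hj
  let N : Matrix V V R := Matrix.of fun x y => if p y ∧ x = σ y then 1 else 0
  have hmulN : ∀ (M : Matrix V V R) x y, (M * N) x y = if p y then M x (σ y) else 0 := by
    intro M x y
    by_cases hy : p y <;> simp [Matrix.mul_apply, N, hy]
  have hNmul : ∀ (M : Matrix V V R) x y, (N * M) x y = if p (σ x) then M (σ x) y else 0 := by
    intro M x y
    have h : ∀ z, (p z ∧ x = σ z) ↔ (p (σ x) ∧ z = σ x) := by
      intro z
      constructor
      · rintro ⟨hz, rfl⟩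
        rw [hσ z]
        exact ⟨hz, rfl⟩
      · rintro ⟨hz, rfl⟩
        exact ⟨hz, (hσ x).symm⟩
    by_cases hy : p (σ x) <;> simp [Matrix.mul_apply, N, h, hy]
  have hNN : N * N = 0 := by
    ext x y
    rw [hmulN]
    split_ifs with hy
    · simp [N, hpσ y hy]
    · rfl
  have hdet : ((1 + N) * A * (1 - N)).det = A.det := by
    have h1 : (1 + N).det * (1 - N).det = 1 := by
      rw [← Matrix.det_mul, add_mul, mul_sub, mul_sub, hNN]
      simp
    rw [Matrix.det_mul, Matrix.det_mul, mul_right_comm, h1, one_mul]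
  have hB : ∀ x y, p y → ((1 + N) * A * (1 - N)) x y =
      A x y - A x (σ y) + if p (σ x) then A (σ x) y - A (σ x) (σ y) else 0 := by
    intro x y hy
    have h2 : (1 + N) * A * (1 - N) = A - A * N + N * (A - A * N) := by noncomm_ring
    rw [h2, Matrix.add_apply, hNmul, Matrix.sub_apply, Matrix.sub_apply, hmulN, hmulN, if_pos hy,
      if_pos hy]
  have hblock := Matrix.twoBlockTriangular_det ((1 + N) * A * (1 - N)) p fun x hx y hy => by
    rw [hB x y hy]
    split_ifs with h
    · rw [hA x y, ← hA x (σ y), hσ y]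
      ring
    · have h4 := hA x y
      rw [hfix x hx h] at h4
      rw [h4, sub_self, zero_add]
  let e : ι ≃ {x // p x} := Equiv.ofInjective a ha
  have hsub : (((1 + N) * A * (1 - N)).toSquareBlockProp p).submatrix e e = A.submatrix a a := by
    ext i j
    have h3 : ((1 + N) * A * (1 - N)) (a i) (a j) = A (a i) (a j) := by
      rw [hB _ _ ⟨j, rfl⟩, if_neg (hpσ _ ⟨i, rfl⟩), hzero, sub_zero, add_zero]
    exact h3
  refine ⟨_, hdet.symm.trans (hblock.trans (congrArg (· * _) ?_))⟩
  rw [← hsub, Matrix.det_submatrix_equiv_self]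
  congr!

end SwapSymmetry

section Continuant

/-- The continuants of a sequence `x 0, x 1, …`. -/
def continuant (x : ℕ → ℤ) : ℕ → ℤ
  | 0 => 1
  | 1 => x 0
  | n + 2 => x (n + 1) * continuant x (n + 1) - continuant x n

/-- The tridiagonal matrix with diagonal `x` and off-diagonal entries `-1`. -/
def continuantMatrix (x : ℕ → ℤ) (n : ℕ) : Matrix (Fin n) (Fin n) ℤ :=
  Matrix.of fun i j =>
    if i = j then x i else if (j : ℕ) = i + 1 ∨ (i : ℕ) = j + 1 then -1 else 0

theorem det_continuantMatrix (x : ℕ → ℤ) (n : ℕ) :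
    (continuantMatrix x n).det = continuant x n := by
  induction n using Nat.twoStepInduction with
  | zero => simp [continuant]
  | one => simp [continuant, continuantMatrix]
  | more n ih0 ih1 =>
    have hminor : (continuantMatrix x (n + 2)).submatrix Fin.castSucc Fin.castSucc =
        continuantMatrix x (n + 1) := by
      ext i j
      simp [continuantMatrix]
    have hminor' : ((continuantMatrix x (n + 2)).submatrix Fin.castSucc
        (Fin.last n).castSucc.succAbove).det = - (continuantMatrix x n).det := by
      rw [Matrix.det_succ_column _ (Fin.last n), Fin.sum_univ_castSucc, Finset.sum_eq_zero]
      · have hsub : ((continuantMatrix x (n + 2)).submatrix Fin.castSucc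
            (Fin.last n).castSucc.succAbove).submatrix (Fin.last n).succAbove
            (Fin.last n).succAbove = continuantMatrix x n := by
          ext i j
          have hj : (Fin.last n).castSucc.succAbove j.castSucc = j.castSucc.castSucc :=
            Fin.succAbove_of_castSucc_lt _ _ (by simp [Fin.lt_def])
          simp [continuantMatrix, hj]
        rw [hsub]
        simp [continuantMatrix, Fin.ext_iff]
      · intro i _
        have : ((i : ℕ) : ℕ) < n := i.2
        simp [continuantMatrix, Fin.ext_iff]
        omega
    rw [Matrix.det_succ_row _ (Fin.last (n + 1)), Fin.sum_univ_castSucc, Fin.sum_univ_castSucc,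
      Finset.sum_eq_zero]
    · rw [Fin.succAbove_last, hminor, hminor', ih0, ih1, continuant]
      simp [continuantMatrix, Fin.ext_iff, ← two_mul, pow_mul]
      ring
    · intro i _
      have : ((i : ℕ) : ℕ) < n := i.2
      simp [continuantMatrix, Fin.ext_iff]
      omega

theorem continuant_pos_and_lt {x : ℕ → ℤ} {n : ℕ} (hx : ∀ i < n + 1, 2 ≤ x i) :
    0 < continuant x n ∧ continuant x n < continuant x (n + 1) := by
  induction n with
  | zero =>
    have := hx 0 one_pos
    simp only [continuant]
    omega
  | succ n ih =>
    obtain ⟨h1, h2⟩ := ih fun i hi => hx i (by omega)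
    have := hx (n + 1) (by omega)
    refine ⟨h1.trans h2, ?_⟩
    rw [continuant]
    nlinarith

/-- Two consecutive continuants determine the underlying continued fraction. -/
theorem eq_of_continuant_eq {x y : ℕ → ℤ} {n : ℕ} (hx : ∀ i < n + 1, 2 ≤ x i)
    (hy : ∀ i < n + 1, 2 ≤ y i) (h : continuant x n = continuant y n)
    (h' : continuant x (n + 1) = continuant y (n + 1)) : ∀ i < n + 1, x i = y i := by
  induction n with
  | zero =>
    intro i hi
    obtain rfl : i = 0 := by omega
    exact h'
  | succ n ih =>
    have hx' : ∀ i < n + 1, 2 ≤ x i := fun i hi => hx i (by omega)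
    have hy' : ∀ i < n + 1, 2 ≤ y i := fun i hi => hy i (by omega)
    obtain ⟨hx0, hx1⟩ := continuant_pos_and_lt hx'
    obtain ⟨hy0, hy1⟩ := continuant_pos_and_lt hy'
    rw [continuant, continuant, h] at h'
    rw [h] at hx1
    have hlast : x (n + 1) = y (n + 1) := by
      rcases lt_trichotomy (x (n + 1)) (y (n + 1)) with hlt | heq | hlt
      · nlinarith
      · exact heq
      · nlinarith
    have hprev : continuant x n = continuant y n := by
      rw [hlast] at h'
      linarith
    intro i hi
    rcases Nat.lt_succ_iff_lt_or_eq.1 hi with hlt | rfl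
    · exact ih hx' hy' hprev h i hlt
    · exact hlast

end Continuant

section DivisorBound

theorem exists_add_one_le_mul_two_rpow {ε : ℝ} (hε : 0 < ε) :
    ∃ c : ℝ, 1 ≤ c ∧ ∀ a : ℕ, (a : ℝ) + 1 ≤ c * (2 : ℝ) ^ (ε * a) := by
  have hlog : 0 < ε * Real.log 2 := mul_pos hε (Real.log_pos one_lt_two)
  refine ⟨max 1 (1 / (ε * Real.log 2)), le_max_left _ _, fun a => ?_⟩
  have h1 : 1 + (ε * Real.log 2) * a ≤ (2 : ℝ) ^ (ε * a) := by
    rw [Real.rpow_def_of_pos two_pos]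
    linarith [Real.add_one_le_exp (Real.log 2 * (ε * a))]
  have h2 : 1 ≤ max 1 (1 / (ε * Real.log 2)) * (ε * Real.log 2) := by
    rw [← div_le_iff₀ hlog]
    exact le_max_right _ _
  have h3 : (a : ℝ) ≤ max 1 (1 / (ε * Real.log 2)) * (ε * Real.log 2) * a :=
    le_mul_of_one_le_left (Nat.cast_nonneg a) h2
  calc (a : ℝ) + 1
      ≤ max 1 (1 / (ε * Real.log 2)) * (ε * Real.log 2) * a + max 1 (1 / (ε * Real.log 2)) :=
        add_le_add h3 (le_max_left _ _)
    _ = max 1 (1 / (ε * Real.log 2)) * (1 + (ε * Real.log 2) * a) := by ring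
    _ ≤ _ := by gcongr

/-- The divisor bound: `d(n) = O(n ^ ε)` for every `ε > 0`. -/
theorem exists_card_divisors_le_rpow {ε : ℝ} (hε : 0 < ε) :
    ∃ C : ℝ, 1 ≤ C ∧ ∀ n : ℕ, n ≠ 0 → (n.divisors.card : ℝ) ≤ C * (n : ℝ) ^ ε := by
  obtain ⟨c, hc, hca⟩ := exists_add_one_le_mul_two_rpow hε
  obtain ⟨B, hB⟩ := exists_nat_ge ((2 : ℝ) ^ (1 / ε))
  refine ⟨c ^ B, one_le_pow₀ hc, fun n hn => ?_⟩
  have hfactor : ∀ p ∈ n.primeFactors, ((n.factorization p + 1 : ℕ) : ℝ) ≤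
      (if p < B then c else 1) * ((p : ℝ) ^ n.factorization p) ^ ε := by
    intro p hp
    have hp2 : (2 : ℝ) ≤ p := by exact_mod_cast (Nat.prime_of_mem_primeFactors hp).two_le
    have hpow : ((p : ℝ) ^ n.factorization p) ^ ε = (p : ℝ) ^ (ε * n.factorization p) := by
      rw [← Real.rpow_natCast, ← Real.rpow_mul (by linarith), mul_comm]
    push_cast
    rw [hpow]
    split_ifs with hpB
    · exact (hca _).trans (by gcongr)
    · have h1 : (2 : ℝ) ≤ (p : ℝ) ^ ε := by
        calc (2 : ℝ) = ((2 : ℝ) ^ (1 / ε)) ^ ε := by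
              rw [← Real.rpow_mul two_pos.le, one_div_mul_cancel hε.ne', Real.rpow_one]
          _ ≤ (p : ℝ) ^ ε := by
              have : (B : ℝ) ≤ p := by exact_mod_cast not_lt.1 hpB
              gcongr
              exact hB.trans this
      rw [one_mul, Real.rpow_mul (by linarith), Real.rpow_natCast]
      calc (n.factorization p : ℝ) + 1 ≤ (2 : ℝ) ^ n.factorization p := by
            exact_mod_cast Nat.lt_two_pow_self (n := n.factorization p)
        _ ≤ _ := by gcongr
  have hprod : ∏ p ∈ n.primeFactors, (if p < B then c else 1) ≤ c ^ B := by
    rw [Finset.prod_ite, Finset.prod_const, Finset.prod_const_one, mul_one]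
    refine pow_le_pow_right₀ hc ?_
    calc _ ≤ (Finset.range B).card := Finset.card_le_card fun p hp => by
            simpa using (Finset.mem_filter.1 hp).2
      _ = B := Finset.card_range B
  have hn' : (n : ℝ) = ∏ p ∈ n.primeFactors, (p : ℝ) ^ n.factorization p := by
    conv_lhs => rw [← Nat.prod_factorization_pow_eq_self hn]
    rw [Finsupp.prod, Nat.support_factorization]
    push_cast
    rfl
  calc (n.divisors.card : ℝ) = ∏ p ∈ n.primeFactors, ((n.factorization p + 1 : ℕ) : ℝ) := by
        rw [Nat.card_divisors hn, Nat.cast_prod]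
    _ ≤ ∏ p ∈ n.primeFactors, ((if p < B then c else 1) * ((p : ℝ) ^ n.factorization p) ^ ε) :=
        Finset.prod_le_prod (fun _ _ => Nat.cast_nonneg _) hfactor
    _ = (∏ p ∈ n.primeFactors, (if p < B then c else 1)) * (n : ℝ) ^ ε := by
        rw [Finset.prod_mul_distrib, Real.finsetProd_rpow _ _ (fun _ _ => by positivity), ← hn']
    _ ≤ _ := by gcongr

end DivisorBound

section TreeCounts
open Finset

section SwapSymmetricGraph

variable {V : Type*} [Fintype V] [DecidableEq V] (G : SimpleGraph V) [DecidableRel G.Adj]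

/-- If a graph has an involutive automorphism exchanging an induced path with a disjoint,
non-adjacent copy and fixing all other vertices, then the number of its spanning trees is divisible
by the continuant of the degrees along this path. -/
theorem continuant_dvd_card_isTree {ρ : V} {σ : V → V} (hσ : Function.Involutive σ)
    (hadj : ∀ x y, G.Adj (σ x) (σ y) ↔ G.Adj x y) (hρ : σ ρ = ρ) {r : ℕ} {a : Fin r → V}
    {x : ℕ → ℤ} (ha : Function.Injective a) (hdisj : ∀ i j, a i ≠ σ (a j))
    (hfix : ∀ x, x ∉ Set.range a → σ x ∉ Set.range a → σ x = x)
    (hnadj : ∀ i j, ¬ G.Adj (a i) (σ (a j))) (hroot : ∀ i, a i ≠ ρ)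
    (hpath : ∀ i j, G.Adj (a i) (a j) ↔ (j : ℕ) = i + 1 ∨ (i : ℕ) = j + 1)
    (hdeg : ∀ i, (G.degree (a i) : ℤ) = x i) :
    continuant x r ∣ (Nat.card {H : SimpleGraph V // H ≤ G ∧ H.IsTree} : ℤ) := by
  have hsub : (rootedLap G ρ).submatrix a a = continuantMatrix x r := by
    ext i j
    by_cases hij : i = j
    · subst hij
      simp [rootedLap, continuantMatrix, hroot, hdeg]
    · have hij' : a j ≠ a i := fun h => hij (ha h).symm
      by_cases hp : (j : ℕ) = i + 1 ∨ (i : ℕ) = j + 1 <;>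
        simp [rootedLap, continuantMatrix, hroot, hpath, hij, hij', hp]
  rw [← det_rootedLap G ρ, ← det_continuantMatrix, ← hsub]
  refine det_submatrix_dvd_det_of_involutive _ hσ (fun x y => ?_) ha hdisj hfix fun i j => ?_
  · have hdegσ : G.degree (σ x) = G.degree x :=
      SimpleGraph.Iso.degree_eq (⟨hσ.toPerm, fun {x y} => hadj x y⟩ : G ≃g G) x
    have hroot' : σ x = ρ ↔ x = ρ := by
      rw [← hσ.injective.eq_iff (a := x), hρ]
    simp [rootedLap, hroot', hdegσ, hadj, hσ.injective.eq_iff]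
  · simp [rootedLap, hroot, (hdisj i j).symm, hnadj]

end SwapSymmetricGraph

theorem sum_path_neighbors {r : ℕ} (i : Fin r) :
    (∑ j : Fin r, if (j : ℕ) = i + 1 ∨ (i : ℕ) = j + 1 then 1 else 0) = pathDeg r (i + 1) := by
  have h1 : (∑ j : Fin r, if (j : ℕ) = i + 1 then 1 else 0) = if (i : ℕ) + 1 < r then 1 else 0 := by
    split_ifs with h
    · have : ∀ j : Fin r, (j : ℕ) = i + 1 ↔ j = ⟨i + 1, h⟩ := fun j => by rw [Fin.ext_iff]
      simp [this]
    · exact sum_eq_zero fun j _ => if_neg (by omega)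
  have h2 : (∑ j : Fin r, if (i : ℕ) = j + 1 then 1 else 0) = if 1 < (i : ℕ) + 1 then 1 else 0 := by
    split_ifs with h
    · have : ∀ j : Fin r, (i : ℕ) = j + 1 ↔ j = ⟨i - 1, by omega⟩ := fun j => by
        simp only [Fin.ext_iff]
        omega
      simp [this]
    · exact sum_eq_zero fun j _ => if_neg (by omega)
  rw [pathDeg, ← h1, ← h2, ← sum_add_distrib]
  refine sum_congr rfl fun j _ => ?_
  split_ifs <;> omega

theorem sum_fin_lt {q h : ℕ} (hq : h ≤ q) : (∑ t : Fin q, if (t : ℕ) < h then 1 else 0) = h := by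
  rw [Fin.sum_univ_eq_sum_range (fun t => if t < h then 1 else 0), ← sum_filter, sum_const,
    smul_eq_mul, mul_one]
  convert card_range h using 2
  ext t
  simp
  omega

namespace Vert

variable {m q : ℕ}

/-- The vertices of `G_w` as a disjoint union of the root, the anchors and the four paths. -/
def equivSum (m q : ℕ) :
    Vert m q ≃ Unit ⊕ Fin q ⊕ Fin m ⊕ Fin m ⊕ Fin (m - 1) ⊕ Fin (m - 1) where
  toFun
    | rho => .inl ()
    | anchor t => .inr (.inl t)
    | u i => .inr (.inr (.inl i))
    | v i => .inr (.inr (.inr (.inl i)))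
    | u' i => .inr (.inr (.inr (.inr (.inl i))))
    | v' i => .inr (.inr (.inr (.inr (.inr i))))
  invFun
    | .inl _ => rho
    | .inr (.inl t) => anchor t
    | .inr (.inr (.inl i)) => u i
    | .inr (.inr (.inr (.inl i))) => v i
    | .inr (.inr (.inr (.inr (.inl i)))) => u' i
    | .inr (.inr (.inr (.inr (.inr i)))) => v' i
  left_inv x := by cases x <;> rfl
  right_inv x := by rcases x with _ | _ | _ | _ | _ | _ <;> rfl

instance : Fintype (Vert m q) := Fintype.ofEquiv _ (equivSum m q).symm

instance : DecidableEq (Vert m q) := (equivSum m q).decidableEq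

theorem card_eq (hm : 1 ≤ m) : Fintype.card (Vert m q) = 4 * m + q - 1 := by
  rw [Fintype.card_congr (equivSum m q)]
  simp only [Fintype.card_sum, Fintype.card_fin, Fintype.card_unit]
  omega

theorem sum_eq (f : Vert m q → ℕ) :
    ∑ x, f x = f rho + ((∑ t, f (anchor t)) + ((∑ i, f (u i)) + ((∑ i, f (v i)) +
      ((∑ i, f (u' i)) + ∑ i, f (v' i))))) := by
  rw [← (equivSum m q).symm.sum_comp]
  simp only [Fintype.sum_sum_type, Fintype.sum_unique]
  rfl

/-- Exchange the paths `u` and `v`. -/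
def swapUV : Vert m q → Vert m q
  | u i => v i
  | v i => u i
  | x => x

/-- Exchange the paths `u'` and `v'`. -/
def swapUV' : Vert m q → Vert m q
  | u' i => v' i
  | v' i => u' i
  | x => x

end Vert

section Gw

variable {m q : ℕ} {w : ℕ → ℕ}

open scoped Classical in
theorem Gw_degree_u (hm : 3 ≤ m) (i : Fin m) (hw : 2 ≤ w (i + 1)) (hw' : w (i + 1) ≤ q + 1) :
    (Gw m q w).degree (.u i) = w (i + 1) := by
  have h1 : 1 ≤ pathDeg m (i + 1) ∧ pathDeg m (i + 1) ≤ 2 := by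
    rw [pathDeg]
    split_ifs <;> omega
  have h2 : ∀ j, (¬ i = j ∧ ((j : ℕ) = i + 1 ∨ (i : ℕ) = j + 1)) ↔
      ((j : ℕ) = i + 1 ∨ (i : ℕ) = j + 1) := fun j => by
    rw [Fin.ext_iff]
    omega
  rw [← SimpleGraph.card_neighborFinset_eq_degree, SimpleGraph.neighborFinset_eq_filter,
    card_filter, Vert.sum_eq]
  simp only [Gw, SimpleGraph.fromRel_adj, edgeRel, ne_eq, reduceCtorEq, not_false_eq_true,
    true_and, or_false, Vert.u.injEq, h2, if_false, sum_const_zero, add_zero, zero_add]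
  rw [sum_fin_lt (by omega), sum_path_neighbors]
  omega

open scoped Classical in
theorem Gw_degree_u' (hm : 3 ≤ m) (i : Fin (m - 1)) (hw : 2 ≤ w (i + 1))
    (hw' : w (i + 1) ≤ q + 1) : (Gw m q w).degree (.u' i) = w (i + 1) := by
  have h1 : 1 ≤ pathDeg (m - 1) (i + 1) ∧ pathDeg (m - 1) (i + 1) ≤ 2 := by
    rw [pathDeg]
    split_ifs <;> omega
  have h2 : ∀ j, (¬ i = j ∧ ((j : ℕ) = i + 1 ∨ (i : ℕ) = j + 1)) ↔
      ((j : ℕ) = i + 1 ∨ (i : ℕ) = j + 1) := fun j => by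
    rw [Fin.ext_iff]
    omega
  rw [← SimpleGraph.card_neighborFinset_eq_degree, SimpleGraph.neighborFinset_eq_filter,
    card_filter, Vert.sum_eq]
  simp only [Gw, SimpleGraph.fromRel_adj, edgeRel, ne_eq, reduceCtorEq, not_false_eq_true,
    true_and, or_false, Vert.u'.injEq, h2, if_false, sum_const_zero, add_zero, zero_add]
  rw [sum_fin_lt (by omega), sum_path_neighbors]
  omega

theorem continuant_dvd_tau (hm : 3 ≤ m) (hw : ∀ i, 1 ≤ i → i ≤ m → 2 ≤ w i ∧ w i ≤ q + 1) :
    continuant (fun i => (w (i + 1) : ℤ)) m ∣ (tau (Gw m q w) : ℤ) := by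
  classical
  refine continuant_dvd_card_isTree (Gw m q w) (ρ := .rho) (σ := Vert.swapUV) (a := Vert.u)
    ?_ ?_ rfl ?_ ?_ ?_ ?_ ?_ ?_ ?_
  · rintro (_ | _ | _ | _ | _ | _) <;> rfl
  · rintro (_ | _ | _ | _ | _ | _) (_ | _ | _ | _ | _ | _) <;>
      simp [Gw, SimpleGraph.fromRel_adj, edgeRel, Vert.swapUV]
  · exact fun i j h => Vert.u.inj h
  · simp [Vert.swapUV]
  · rintro (_ | _ | _ | _ | _ | _) <;> simp [Vert.swapUV]
  · simp [Gw, SimpleGraph.fromRel_adj, edgeRel, Vert.swapUV]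
  · simp
  · intro i j
    simp only [Gw, SimpleGraph.fromRel_adj, edgeRel, ne_eq, Vert.u.injEq, Fin.ext_iff]
    omega
  · intro i
    obtain ⟨h1, h2⟩ := hw (i + 1) (by omega) (by omega)
    rw [Gw_degree_u hm i h1 h2]

theorem continuant_pred_dvd_tau (hm : 3 ≤ m)
    (hw : ∀ i, 1 ≤ i → i ≤ m → 2 ≤ w i ∧ w i ≤ q + 1) :
    continuant (fun i => (w (i + 1) : ℤ)) (m - 1) ∣ (tau (Gw m q w) : ℤ) := by
  classical
  refine continuant_dvd_card_isTree (Gw m q w) (ρ := .rho) (σ := Vert.swapUV') (a := Vert.u')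
    ?_ ?_ rfl ?_ ?_ ?_ ?_ ?_ ?_ ?_
  · rintro (_ | _ | _ | _ | _ | _) <;> rfl
  · rintro (_ | _ | _ | _ | _ | _) (_ | _ | _ | _ | _ | _) <;>
      simp [Gw, SimpleGraph.fromRel_adj, edgeRel, Vert.swapUV']
  · exact fun i j h => Vert.u'.inj h
  · simp [Vert.swapUV']
  · rintro (_ | _ | _ | _ | _ | _) <;> simp [Vert.swapUV']
  · simp [Gw, SimpleGraph.fromRel_adj, edgeRel, Vert.swapUV']
  · simp
  · intro i j
    simp only [Gw, SimpleGraph.fromRel_adj, edgeRel, ne_eq, Vert.u'.injEq, Fin.ext_iff]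
    omega
  · intro i
    obtain ⟨h1, h2⟩ := hw (i + 1) (by omega) (by omega)
    rw [Gw_degree_u' hm i h1 h2]

theorem reachable_of_forall_adj_succ {V : Type*} {G : SimpleGraph V} {ρ : V} {r : ℕ}
    {a : Fin r → V} (h0 : ∀ i : Fin r, (i : ℕ) = 0 → G.Reachable ρ (a i))
    (hsucc : ∀ i j : Fin r, (j : ℕ) = i + 1 → G.Adj (a i) (a j)) (i : Fin r) : G.Reachable ρ (a i) := by
  obtain ⟨i, hi⟩ := i
  induction i with
  | zero => exact h0 _ rfl
  | succ i ih => exact (ih (by omega)).trans (hsucc ⟨i, by omega⟩ ⟨i + 1, hi⟩ rfl).reachable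

theorem Gw_connected (hq : 1 ≤ q) (hw : 2 ≤ w 1) : (Gw m q w).Connected := by
  rw [SimpleGraph.connected_iff_exists_forall_reachable]
  refine ⟨.rho, ?_⟩
  have hanchor : ∀ t, (Gw m q w).Reachable .rho (.anchor t) := fun t =>
    SimpleGraph.Adj.reachable (by simp [Gw, SimpleGraph.fromRel_adj, edgeRel])
  have hdeg : ∀ r, pathDeg r 1 ≤ 1 := fun r => by
    rw [pathDeg]
    split_ifs <;> omega
  have hdeg1 := hdeg m
  have hdeg2 := hdeg (m - 1)
  rintro (_ | t | i | i | i | i)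
  · rfl
  · exact hanchor t
  all_goals
    refine reachable_of_forall_adj_succ (fun i hi => (hanchor ⟨0, hq⟩).trans
      (SimpleGraph.Adj.reachable ?_)) (fun i j hij => ?_) i
    · simp [Gw, SimpleGraph.fromRel_adj, edgeRel, hi]
      omega
    · simp [Gw, SimpleGraph.fromRel_adj, edgeRel, hij, Fin.ext_iff]

theorem tau_Gw_pos (hq : 1 ≤ q) (hw : 2 ≤ w 1) : 0 < tau (Gw m q w) := by
  obtain ⟨T, hle, hT⟩ := (Gw_connected hq hw).exists_isTree_le
  have : Nonempty {H : SimpleGraph (Vert m q) // H ≤ Gw m q w ∧ H.IsTree} := ⟨⟨T, hle, hT⟩⟩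
  exact Nat.card_pos

theorem tau_Gw_le (hm : 1 ≤ m) : tau (Gw m q w) ≤ (4 * m + q - 1) ^ (4 * m + q - 1) := by
  classical
  rw [← Vert.card_eq hm]
  exact card_isTree_le (Gw m q w) .rho

/-- The set of tree counts of the graphs `G_w`. -/
def treeCounts (m q : ℕ) : Set ℕ :=
  {t : ℕ | ∃ w : ℕ → ℕ, (∀ i, 1 ≤ i → i ≤ m → 2 ≤ w i ∧ w i ≤ q + 1) ∧ tau (Gw m q w) = t}

theorem treeCounts_finite (hm : 1 ≤ m) : (treeCounts m q).Finite :=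
  (Set.finite_Iic _).subset fun _ ⟨_, _, ht⟩ => ht ▸ tau_Gw_le hm

/-- Each tree count `t` arises from at most `d(t) ^ 2` sequences `w`. -/
theorem pow_le_mul_ncard_treeCounts (hm : 3 ≤ m) (hq : 1 ≤ q) {D : ℕ}
    (hD : ∀ t, 0 < t → t ≤ (4 * m + q - 1) ^ (4 * m + q - 1) → #t.divisors ≤ D) :
    q ^ m ≤ D ^ 2 * (treeCounts m q).ncard := by
  classical
  let W : (Fin m → Fin q) → ℕ → ℕ := fun f i => if h : i - 1 < m then f ⟨i - 1, h⟩ + 2 else 2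
  let x : (Fin m → Fin q) → ℕ → ℤ := fun f i => (W f (i + 1) : ℤ)
  have hW2 : ∀ f i, 2 ≤ W f i := fun f i => by
    simp only [W]
    split_ifs <;> omega
  have hW : ∀ f i, 1 ≤ i → i ≤ m → 2 ≤ W f i ∧ W f i ≤ q + 1 := fun f i _ _ => by
    refine ⟨hW2 f i, ?_⟩
    simp only [W]
    split_ifs <;> omega
  have hx : ∀ f i, 2 ≤ x f i := fun f i => Int.ofNat_le.2 (hW2 f (i + 1))
  have hpos : ∀ f n, 0 < continuant (x f) n := fun f n =>
    (continuant_pos_and_lt fun i _ => hx f i).1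
  have hfin := treeCounts_finite (q := q) (m := m) (by omega)
  have hmaps : ∀ f ∈ (univ : Finset (Fin m → Fin q)), tau (Gw m q (W f)) ∈ hfin.toFinset :=
    fun f _ => hfin.mem_toFinset.2 ⟨W f, hW f, rfl⟩
  have key := card_le_mul_card_image_of_maps_to hmaps (D ^ 2) fun t ht => ?_
  · rwa [card_univ, Fintype.card_fun, Fintype.card_fin, Fintype.card_fin,
      ← Set.ncard_eq_toFinset_card _ hfin] at key
  · have ht' : 0 < t ∧ t ≤ (4 * m + q - 1) ^ (4 * m + q - 1) := by
      obtain ⟨w, hw, rfl⟩ := hfin.mem_toFinset.1 ht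
      exact ⟨tau_Gw_pos hq (hw 1 le_rfl (by omega)).1, tau_Gw_le (by omega)⟩
    calc _ ≤ #(t.divisors ×ˢ t.divisors) := ?_
      _ ≤ D ^ 2 := by
        rw [card_product, ← sq]
        exact Nat.pow_le_pow_left (hD t ht'.1 ht'.2) 2
    refine card_le_card_of_injOn
      (fun f => ((continuant (x f) (m - 1)).natAbs, (continuant (x f) m).natAbs)) ?_ ?_
    · intro f hf
      obtain rfl := (mem_filter.1 hf).2
      simp only [coe_product, Set.mem_prod, mem_coe, Nat.mem_divisors, ← Int.natCast_dvd_natCast,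
        Int.natAbs_dvd]
      exact ⟨⟨continuant_pred_dvd_tau hm (hW f), ht'.1.ne'⟩,
        ⟨continuant_dvd_tau hm (hW f), ht'.1.ne'⟩⟩
    · intro f _ g _ hfg
      obtain ⟨h1, h2⟩ := Prod.ext_iff.1 hfg
      have h1' := Int.natAbs_inj_of_nonneg_of_nonneg (hpos f _).le (hpos g _).le |>.1 h1
      have h2' := Int.natAbs_inj_of_nonneg_of_nonneg (hpos f _).le (hpos g _).le |>.1 h2
      obtain ⟨n, rfl⟩ : ∃ n, m = n + 1 := ⟨m - 1, by omega⟩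
      have heq := eq_of_continuant_eq (fun i _ => hx f i) (fun i _ => hx g i) h1' h2'
      funext i
      have := heq i i.2
      simp only [x, W, Nat.add_sub_cancel, i.2, dif_pos, Fin.eta, Nat.cast_inj] at this
      exact Fin.ext (by omega)

end Gw

end TreeCounts

theorem many_distinct_tree_counts (η : ℝ) (hη : 0 < η) :
    ∃ C : ℕ, ∀ m q : ℕ, 3 ≤ m → 1 ≤ q → C ≤ m + q →
      (q : ℝ) ^ m /
          (((q : ℝ) + 1) ^ (2 * η * (m : ℝ)) *
            ((4 * m + q - 1 : ℕ) : ℝ) ^ (η * ((4 * m + q - 1 : ℕ) : ℝ))) ≤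
        (Set.ncard {t : ℕ | ∃ w : ℕ → ℕ,
          (∀ i, 1 ≤ i → i ≤ m → 2 ≤ w i ∧ w i ≤ q + 1) ∧
            tau (Gw m q w) = t} : ℝ) := by
  obtain ⟨c, hc, hdiv⟩ := exists_card_divisors_le_rpow (ε := η / 4) (by positivity)
  obtain ⟨M, hM⟩ := exists_nat_ge (Real.logb 2 (c ^ 2) / (η / 2))
  refine ⟨M, fun m q hm hq hMmq => ?_⟩
  change _ ≤ ((treeCounts m q).ncard : ℝ)
  have hMN : M ≤ 4 * m + q - 1 := by omega
  have hN : 2 ≤ 4 * m + q - 1 := by omega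
  generalize hNdef : 4 * m + q - 1 = N at *
  have hN2 : (2 : ℝ) ≤ N := by exact_mod_cast hN
  have hcN : c ^ 2 ≤ (N : ℝ) ^ (η / 2 * N) := by
    have hc0 : (0 : ℝ) < c ^ 2 := by positivity
    rw [div_le_iff₀ (by positivity)] at hM
    calc c ^ 2 = (2 : ℝ) ^ Real.logb 2 (c ^ 2) :=
          (Real.rpow_logb two_pos (by norm_num) hc0).symm
      _ ≤ (2 : ℝ) ^ (η / 2 * N) := by
          refine Real.rpow_le_rpow_of_exponent_le one_le_two (hM.trans ?_)
          rw [mul_comm]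
          gcongr
      _ ≤ (N : ℝ) ^ (η / 2 * N) := by gcongr
  have hD : ∀ t : ℕ, 0 < t → t ≤ N ^ N →
      t.divisors.card ≤ ⌊c * (N : ℝ) ^ (η / 4 * N)⌋₊ := by
    intro t ht htN
    refine Nat.le_floor ((hdiv t ht.ne').trans ?_)
    have h1 : (t : ℝ) ≤ (N : ℝ) ^ N := by exact_mod_cast htN
    have h2 : (N : ℝ) ^ (η / 4 * N) = ((N : ℝ) ^ N) ^ (η / 4) := by
      rw [← Real.rpow_natCast, ← Real.rpow_mul (by linarith), mul_comm]
    rw [h2]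
    gcongr
  rw [← hNdef] at hD
  have hcount := pow_le_mul_ncard_treeCounts hm hq hD
  rw [hNdef] at hcount
  have hfloor : ((⌊c * (N : ℝ) ^ (η / 4 * N)⌋₊ : ℕ) : ℝ) ≤ c * (N : ℝ) ^ (η / 4 * N) :=
    Nat.floor_le (by positivity)
  have hsq : (c * (N : ℝ) ^ (η / 4 * N)) ^ 2 ≤ (N : ℝ) ^ (η * N) := by
    have h3 : ((N : ℝ) ^ (η / 4 * N)) ^ 2 = (N : ℝ) ^ (η / 2 * N) := by
      rw [← Real.rpow_natCast, ← Real.rpow_mul (by linarith)]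
      congr 1
      push_cast
      ring
    calc (c * (N : ℝ) ^ (η / 4 * N)) ^ 2 = c ^ 2 * (N : ℝ) ^ (η / 2 * N) := by rw [mul_pow, h3]
      _ ≤ (N : ℝ) ^ (η / 2 * N) * (N : ℝ) ^ (η / 2 * N) := by gcongr
      _ = (N : ℝ) ^ (η * N) := by
          rw [← Real.rpow_add (by linarith)]
          congr 1
          ring
  have hone : 1 ≤ ((q : ℝ) + 1) ^ (2 * η * (m : ℝ)) :=
    Real.one_le_rpow (by linarith [(Nat.cast_nonneg q : (0 : ℝ) ≤ q)]) (by positivity)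
  rw [div_le_iff₀ (by positivity)]
  calc (q : ℝ) ^ m
      ≤ ((⌊c * (N : ℝ) ^ (η / 4 * N)⌋₊ : ℕ) : ℝ) ^ 2 * (treeCounts m q).ncard := by
        exact_mod_cast hcount
    _ ≤ (c * (N : ℝ) ^ (η / 4 * N)) ^ 2 * (treeCounts m q).ncard := by gcongr
    _ ≤ (N : ℝ) ^ (η * N) * (treeCounts m q).ncard := by gcongr
    _ ≤ ((q : ℝ) + 1) ^ (2 * η * (m : ℝ)) * (N : ℝ) ^ (η * N) * (treeCounts m q).ncard := by
        gcongr
        exact le_mul_of_one_le_left (by positivity) hone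
    _ = _ := mul_comm _ _
end
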